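/- Let d ≥ 1 be an integer, α ∈ (0,2), r_1 ∈ (0, 1/2] and p ∈ (α/2, α). Then there exist δ ∈ (0, r_1/4] and constants C ≥ c > 0, depending only on α, p, d and r_1, such that for every y ∈ V_δ the limit defining the truncated fractional Laplacian Δ̂^{α/2} h_p(y) exists and c · (y_d − √(r_1² − |ỹ|²))^{p−α} ≤ Δ̂^{α/2} h_p(y) ≤ C · (y_d − √(r_1² − |ỹ|²))^{p−α}. -/

import Mathlib

open MeasureTheory Filter Set

/-- The constant 𝒜(d, -α) = α 2^{α-1} π^{-d/2} Γ((d+α)/2) Γ(1-α/2)^{-1}. -/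
noncomputable def fracConst (d : ℕ) (α : ℝ) : ℝ :=
  α * 2 ^ (α - 1) * Real.pi ^ (-(d : ℝ) / 2) *
    Real.Gamma (((d : ℝ) + α) / 2) / Real.Gamma (1 - α / 2)

/-- The Euclidean norm on ℝ^{m} × ℝ ≅ ℝ^{m+1}, writing y = (ỹ, y_d). -/
noncomputable def enorm' {m : ℕ} (y : EuclideanSpace ℝ (Fin m) × ℝ) : ℝ :=
  Real.sqrt (‖y.1‖ ^ 2 + y.2 ^ 2)

/-- The truncated integral ∫_{ε<|y-x|≤1} (u(y)-u(x)) |x-y|^{-d-α} dy on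
ℝ^{d-1} × ℝ ≅ ℝ^d, whose limit as ε ↓ 0 defines the truncated fractional Laplacian
Δ̂^{α/2}u(x) (up to the constant `fracConst d α`). -/
noncomputable def pvInt2Tr (d : ℕ) (α : ℝ)
    (u : EuclideanSpace ℝ (Fin (d - 1)) × ℝ → ℝ)
    (x : EuclideanSpace ℝ (Fin (d - 1)) × ℝ) (ε : ℝ) : ℝ :=
  ∫ y in {y : EuclideanSpace ℝ (Fin (d - 1)) × ℝ |
      ε < enorm' (y - x) ∧ enorm' (y - x) ≤ 1},
    (u y - u x) / enorm' (x - y) ^ ((d : ℝ) + α)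

/-- h_p(y) = (y_d - √(r₁² - |ỹ|²))^p on {r₁ < |y| < 3r₁/2, y_d > 0, |ỹ| < r₁/2},
and 0 otherwise. -/
noncomputable def hfun (d : ℕ) (r1 p : ℝ)
    (y : EuclideanSpace ℝ (Fin (d - 1)) × ℝ) : ℝ :=
  if r1 < enorm' y ∧ enorm' y < 3 * r1 / 2 ∧ 0 < y.2 ∧ ‖y.1‖ < r1 / 2 then
    (y.2 - Real.sqrt (r1 ^ 2 - ‖y.1‖ ^ 2)) ^ p
  else 0

/-- The common growth bound `min (t ^ 2) (t ^ p)` of the second differences considered below. -/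
noncomputable def minPow (p t : ℝ) : ℝ := min (t ^ 2) (t ^ p)

/-- The second difference at `1` with step `s` of the function `t ↦ t₊ ^ p`. -/
noncomputable def posPowDiff (p s : ℝ) : ℝ := max (1 + s) 0 ^ p + max (1 - s) 0 ^ p - 2

lemma measurable_minPow (p : ℝ) : Measurable (minPow p) := by
  unfold minPow; fun_prop

lemma measurable_posPowDiff (p : ℝ) : Measurable (posPowDiff p) := by
  unfold posPowDiff; fun_prop

lemma minPow_nonneg (p : ℝ) {t : ℝ} (ht : 0 ≤ t) : 0 ≤ minPow p t := by
  unfold minPow; positivity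

lemma posPowDiff_neg (p s : ℝ) : posPowDiff p (-s) = posPowDiff p s := by
  unfold posPowDiff
  rw [sub_neg_eq_add, ← sub_eq_add_neg]
  ring

lemma posPowDiff_abs (p s : ℝ) : posPowDiff p |s| = posPowDiff p s := by
  rcases abs_choice s with h | h <;> rw [h]
  exact posPowDiff_neg p s

lemma minPow_of_le_one {p t : ℝ} (hp2 : p ≤ 2) (ht : 0 ≤ t) (ht1 : t ≤ 1) :
    minPow p t = t ^ 2 := by
  rcases ht.eq_or_lt with rfl | h0
  · unfold minPow
    rw [min_eq_left]
    simpa using Real.rpow_nonneg le_rfl p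
  refine min_eq_left ?_
  rw [← Real.rpow_natCast t 2]
  exact Real.rpow_le_rpow_of_exponent_ge h0 ht1 (by simpa using hp2)

lemma minPow_of_one_le {p t : ℝ} (hp2 : p ≤ 2) (ht1 : 1 ≤ t) :
    minPow p t = t ^ p := by
  refine min_eq_right ?_
  rw [← Real.rpow_natCast t 2]
  exact Real.rpow_le_rpow_of_exponent_le ht1 (by simpa using hp2)

lemma rpow_le_minPow {p t : ℝ} (hp0 : 0 ≤ p) (hp2 : p ≤ 2) (ht : 1 / 4 ≤ t) :
    t ^ p ≤ 16 * minPow p t := by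
  rcases le_total t 1 with h | h
  · rw [minPow_of_le_one hp2 (by linarith) h]
    have h1 : t ^ p ≤ 1 := Real.rpow_le_one (by linarith) h hp0
    nlinarith
  · rw [minPow_of_one_le hp2 h]
    have : 0 ≤ t ^ p := Real.rpow_nonneg (by linarith) p
    linarith

lemma abs_rpow_one_add_sub_le {p s : ℝ} (hp0 : 0 ≤ p) (hp2 : p ≤ 2) (hs : -1 / 2 ≤ s) :
    |(1 + s) ^ p - 1 - p * s| ≤ 8 * s ^ 2 := by
  have upper : ∀ u : ℝ, -1 ≤ u → (1 + u) ^ p ≤ 1 + p * u + p / 2 * u ^ 2 := by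
    intro u hu
    have h := rpow_one_add_le_one_add_mul_self (s := 2 * u + u ^ 2) (by nlinarith [sq_nonneg (1 + u)])
      (p := p / 2) (by linarith) (by linarith)
    have e : (1 + (2 * u + u ^ 2)) ^ (p / 2) = (1 + u) ^ p := by
      rw [show 1 + (2 * u + u ^ 2) = (1 + u) ^ (2 : ℝ) by norm_num; ring,
        ← Real.rpow_mul (by linarith)]
      congr 1; ring
    rw [e] at h
    linarith
  have h1 := upper s (by linarith)
  have hs0 : 0 < 1 + s := by linarith
  set v := (1 + s)⁻¹ with hv
  have hvs : v * (1 + s) = 1 := inv_mul_cancel₀ hs0.ne'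
  have hv0 : 0 < v := inv_pos.2 hs0
  have hv2 : v ≤ 2 := by
    rw [hv, inv_le_comm₀ hs0 (by norm_num)]; linarith
  have h2 := upper (-s * v) (by nlinarith)
  rw [show 1 + -s * v = v by linarith, hv, Real.inv_rpow hs0.le, ← hv] at h2
  set A := (1 + s) ^ p with hA
  have hA0 : 0 < A := Real.rpow_pos_of_pos hs0 p
  have hAi : 0 < A⁻¹ := inv_pos.2 hA0
  have h3 : 1 - (A⁻¹ - 1) ≤ A := by
    have : A⁻¹ * A = 1 := inv_mul_cancel₀ hA0.ne'
    nlinarith [sq_nonneg (A⁻¹ - 1), sq_nonneg (A - 1)]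
  have h4 : s * v = s - s ^ 2 * v := by linear_combination s * hvs
  have h5 : (s * v) ^ 2 ≤ 4 * s ^ 2 := by
    rw [mul_pow]; nlinarith [sq_nonneg s]
  have h6 : s ^ 2 * v ≤ s ^ 2 * 2 := mul_le_mul_of_nonneg_left hv2 (sq_nonneg s)
  have h7 : p * (s ^ 2 * v) ≤ 2 * (s ^ 2 * 2) :=
    mul_le_mul hp2 h6 (by positivity) (by norm_num)
  have h8 : p / 2 * (s * v) ^ 2 ≤ 1 * (4 * s ^ 2) :=
    mul_le_mul (by linarith) h5 (by positivity) (by norm_num)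
  have h9 : p * (-s * v) = - (p * s) + p * (s ^ 2 * v) := by
    linear_combination (-p) * h4
  have h10 : (-s * v) ^ 2 = (s * v) ^ 2 := by ring
  rw [h10] at h2
  have h11 : p / 2 * s ^ 2 ≤ s ^ 2 := by nlinarith [sq_nonneg s]
  rw [abs_le]
  constructor <;> nlinarith [sq_nonneg s]

lemma abs_rpow_add_rpow_sub_two_le {p s e₁ e₂ t : ℝ} (hp0 : 0 ≤ p) (hp2 : p ≤ 2)
    (ht0 : 0 ≤ t) (ht : t ≤ 1 / 4) (hs : |s| ≤ 2 * t)
    (h₁ : 0 ≤ e₁) (h₁' : e₁ ≤ t ^ 2) (h₂ : 0 ≤ e₂) (h₂' : e₂ ≤ t ^ 2) :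
    |(1 + s + e₁) ^ p + (1 - s + e₂) ^ p - 2| ≤ 128 * t ^ 2 := by
  obtain ⟨hs1, hs2⟩ := abs_le.1 hs
  have k1 := abs_le.1 (abs_rpow_one_add_sub_le hp0 hp2 (s := s + e₁) (by linarith))
  have k2 := abs_le.1 (abs_rpow_one_add_sub_le hp0 hp2 (s := -s + e₂) (by linarith))
  rw [show 1 + (s + e₁) = 1 + s + e₁ by ring] at k1
  rw [show 1 + (-s + e₂) = 1 - s + e₂ by ring] at k2
  have q1 : (s + e₁) ^ 2 ≤ 6 * t ^ 2 := by
    have : (s + e₁) ^ 2 ≤ (9 / 4 * t) ^ 2 := sq_le_sq' (by nlinarith) (by nlinarith)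
    nlinarith
  have q2 : (-s + e₂) ^ 2 ≤ 6 * t ^ 2 := by
    have : (-s + e₂) ^ 2 ≤ (9 / 4 * t) ^ 2 := sq_le_sq' (by nlinarith) (by nlinarith)
    nlinarith
  have q3 : p * (e₁ + e₂) ≤ 2 * (2 * t ^ 2) :=
    mul_le_mul hp2 (by linarith) (by linarith) (by norm_num)
  have q4 : 0 ≤ p * (e₁ + e₂) := by positivity
  rw [abs_le]
  constructor <;> nlinarith

lemma abs_add_sub_two_le {p a b t : ℝ} (hp0 : 0 ≤ p) (hp2 : p ≤ 2) (ht : 1 / 4 ≤ t)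
    (ha : 0 ≤ a) (ha' : a ≤ (8 * t) ^ p) (hb : 0 ≤ b) (hb' : b ≤ (8 * t) ^ p) :
    |a + b - 2| ≤ 2048 * minPow p t := by
  have h1 := rpow_le_minPow hp0 hp2 ht
  have h2 : (8 * t) ^ p ≤ 64 * t ^ p := by
    rw [Real.mul_rpow (by norm_num) (by linarith)]
    refine mul_le_mul_of_nonneg_right ?_ (Real.rpow_nonneg (by linarith) p)
    calc (8 : ℝ) ^ p ≤ 8 ^ (2 : ℝ) := Real.rpow_le_rpow_of_exponent_le (by norm_num) hp2
      _ = 64 := by norm_num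
  have h3 : (1 : ℝ) ≤ (8 * t) ^ p := Real.one_le_rpow (by linarith) hp0
  rw [abs_le]
  constructor <;> linarith

lemma abs_posPowDiff_le {p s t : ℝ} (hp0 : 0 ≤ p) (hp2 : p ≤ 2) (hs : |s| ≤ 2 * t) :
    |posPowDiff p s| ≤ 2048 * minPow p t := by
  have ht0 : 0 ≤ t := by linarith [abs_nonneg s]
  obtain ⟨hs1, hs2⟩ := abs_le.1 hs
  unfold posPowDiff
  rcases le_total t (1 / 4) with h | h
  · rw [max_eq_left (by linarith), max_eq_left (by linarith), minPow_of_le_one hp2 ht0 (by linarith)]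
    have := abs_rpow_add_rpow_sub_two_le (e₁ := 0) (e₂ := 0) hp0 hp2 ht0 h hs le_rfl
      (by positivity) le_rfl (by positivity)
    simp only [add_zero] at this
    nlinarith [sq_nonneg t]
  · refine abs_add_sub_two_le hp0 hp2 h (by positivity) ?_ (by positivity) ?_ <;>
    exact Real.rpow_le_rpow (le_max_right _ _) (max_le (by linarith) (by linarith)) hp0

lemma integrableOn_minPow_mul_rpow {p α : ℝ} (hα2 : α < 2) (hp2 : p ≤ 2) (hpα : p < α) :
    IntegrableOn (fun t : ℝ => minPow p t * t ^ (-1 - α)) (Ioi 0) := by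
  rw [← Ioo_union_Ici_eq_Ioi (zero_lt_one' ℝ), integrableOn_union]
  constructor
  · have h : IntegrableOn (fun t : ℝ => t ^ (1 - α)) (Ioo 0 1) :=
      (intervalIntegral.integrableOn_Ioo_rpow_iff one_pos).2 (by linarith)
    refine h.congr_fun (fun t ht => ?_) measurableSet_Ioo
    dsimp only
    rw [minPow_of_le_one hp2 ht.1.le ht.2.le, ← Real.rpow_natCast t 2, ← Real.rpow_add ht.1]
    congr 1; push_cast; ring
  · rw [integrableOn_Ici_iff_integrableOn_Ioi]
    have h : IntegrableOn (fun t : ℝ => t ^ (p - 1 - α)) (Ioi 1) :=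
      integrableOn_Ioi_rpow_of_lt (by linarith) one_pos
    refine h.congr_fun (fun t (ht : 1 < t) => ?_) measurableSet_Ioi
    dsimp only
    rw [minPow_of_one_le hp2 ht.le, ← Real.rpow_add (by linarith)]
    congr 1; ring

lemma integrableOn_posPowDiff_mul_rpow {p α : ℝ} (hα2 : α < 2) (hp0 : 0 ≤ p) (hp2 : p ≤ 2)
    (hpα : p < α) :
    IntegrableOn (fun t : ℝ => posPowDiff p t * t ^ (-1 - α)) (Ioi 0) := by
  refine Integrable.mono' ((integrableOn_minPow_mul_rpow hα2 hp2 hpα).const_mul 2048)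
    ((measurable_posPowDiff p).mul (by fun_prop)).aestronglyMeasurable ?_
  refine (ae_restrict_iff' measurableSet_Ioi).2 (ae_of_all _ fun t (ht : 0 < t) => ?_)
  have h1 : 0 ≤ t ^ (-1 - α) := Real.rpow_nonneg ht.le _
  rw [Real.norm_eq_abs, abs_mul, abs_of_nonneg h1, ← mul_assoc]
  refine mul_le_mul_of_nonneg_right (abs_posPowDiff_le hp0 hp2 ?_) h1
  rw [abs_of_pos ht]; linarith

/-- The combination of `y ^ p` and its image under the inversion `y ↦ y⁻¹` that appears when the
half-line `(1, ∞)` is folded onto `(0, 1)`, as a function of `a = 1 - y`. -/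
noncomputable def foldPow (α p a : ℝ) : ℝ :=
  ((1 - a) ^ p - 1 + ((1 - a) ^ (α - 1 - p) - (1 - a) ^ (α - 1))) * a ^ (-1 - α)

lemma foldPow_half_lt {α p a : ℝ} (hp : α / 2 < p) (ha : a ∈ Ioo (0 : ℝ) 1) :
    foldPow α (α / 2) a < foldPow α p a := by
  obtain ⟨h0, h1⟩ := ha
  have hy0 : 0 < 1 - a := by linarith
  have hy1 : 1 - a < 1 := by linarith
  refine mul_lt_mul_of_pos_right ?_ (Real.rpow_pos_of_pos h0 _)
  have e1 : (1 - a) ^ (α - 1 - p) = (1 - a) ^ (α / 2) * (1 - a) ^ (α - 1 - p - α / 2) := by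
    rw [← Real.rpow_add hy0]; congr 1; ring
  have e2 : (1 - a) ^ (α - 1 - α / 2) = (1 - a) ^ p * (1 - a) ^ (α - 1 - p - α / 2) := by
    rw [← Real.rpow_add hy0]; congr 1; ring
  have l1 : (1 - a) ^ p < (1 - a) ^ (α / 2) := Real.rpow_lt_rpow_of_exponent_gt hy0 hy1 hp
  have l2 : 1 < (1 - a) ^ (α - 1 - p - α / 2) :=
    Real.one_lt_rpow_of_pos_of_lt_one_of_neg hy0 hy1 (by linarith)
  rw [e1, e2]
  nlinarith

lemma integrableOn_foldPow {α p η : ℝ} (hp0 : 0 < p) (hpα : p < α)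
    (hη : 0 < η) (hη1 : η < 1) :
    IntegrableOn (foldPow α p) (Ioo η 1) := by
  have key : ∀ r : ℝ, -1 < r → IntegrableOn (fun a : ℝ => (1 - a) ^ r) (Ioo η 1) := by
    intro r hr
    have h := (intervalIntegral.intervalIntegrable_rpow' (a := 0) (b := 1 - η) hr).comp_sub_left 1
    rw [sub_zero, sub_sub_cancel] at h
    exact (intervalIntegrable_iff_integrableOn_Ioo_of_le hη1.le).1 h.symm
  have h1 : IntegrableOn (fun a : ℝ => (1 - a) ^ p - 1 + ((1 - a) ^ (α - 1 - p) - (1 - a) ^ (α - 1)))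
      (Ioo η 1) :=
    ((key p (by linarith)).sub (integrableOn_const (by simp))).add
      ((key _ (by linarith)).sub (key _ (by linarith)))
  refine Integrable.mul_of_top_left h1 (memLp_top_of_bound (by fun_prop) (η ^ (-1 - α)) ?_)
  refine (ae_restrict_iff' measurableSet_Ioo).2 (ae_of_all _ fun t ht => ?_)
  rw [Real.norm_eq_abs, abs_of_nonneg (Real.rpow_nonneg (by linarith [ht.1]) _)]
  exact Real.rpow_le_rpow_of_nonpos hη ht.1.le (by linarith)

lemma integral_foldPow_half {α η : ℝ} (hα : 0 < α) (hη : 0 < η) (hη1 : η < 1) :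
    ∫ a in Ioo η 1, foldPow α (α / 2) a
      = α⁻¹ - α⁻¹ * (η ^ (-α) * (1 - (1 - η) ^ (α / 2)) ^ 2) := by
  have hint := integrableOn_foldPow (α := α) (p := α / 2)  (by linarith) (by linarith) hη hη1
  have hint' := (intervalIntegrable_iff_integrableOn_Ioo_of_le hη1.le).2 hint
  rw [← integral_Ioc_eq_integral_Ioo, ← intervalIntegral.integral_of_le hη1.le,
    intervalIntegral.integral_eq_sub_of_hasDerivAt_of_le hη1.le
      (f := fun a : ℝ => α⁻¹ * (a ^ (-α) * (1 - (1 - a) ^ (α / 2)) ^ 2)) ?_ ?_ hint']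
  · simp [Real.zero_rpow (show α / 2 ≠ 0 by linarith)]
  · refine ContinuousOn.mul continuousOn_const (ContinuousOn.mul ?_ ?_)
    · exact continuousOn_id.rpow_const fun x hx => Or.inl (by linarith [hx.1] : x > 0).ne'
    · exact ((continuousOn_const.sub ((continuousOn_const.sub continuousOn_id).rpow_const
        fun x hx => Or.inr (by linarith))).pow 2)
  · intro a ha
    have h0 : 0 < a := by linarith [ha.1]
    have h1 : 0 < 1 - a := by linarith [ha.2]
    have d1 : HasDerivAt (fun a : ℝ => a ^ (-α)) (-α * a ^ (-α - 1)) a :=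
      Real.hasDerivAt_rpow_const (Or.inl h0.ne')
    have d2 : HasDerivAt (fun a : ℝ => (1 - a) ^ (α / 2)) ((-1) * (α / 2) * (1 - a) ^ (α / 2 - 1)) a :=
      ((hasDerivAt_id a).const_sub 1).rpow_const (Or.inl h1.ne')
    have d3 := (d1.mul ((d2.const_sub 1).pow 2)).const_mul α⁻¹
    refine d3.congr_deriv ?_
    have e1 : a ^ (-α) = a * a ^ (-1 - α) := by
      rw [← Real.rpow_one_add' h0.le (by linarith)]; congr 1; ring
    have e2 : a ^ (-α - 1) = a ^ (-1 - α) := by congr 1; ring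
    have e3 : (1 - a) ^ (α / 2) = (1 - a) * (1 - a) ^ (α / 2 - 1) := by
      rw [← Real.rpow_one_add' h1.le (by linarith)]; congr 1; ring
    have e4 : (1 - a) ^ (α - 1) = (1 - a) * ((1 - a) ^ (α / 2 - 1)) ^ 2 := by
      rw [← Real.rpow_natCast, ← Real.rpow_mul h1.le]
      nth_rewrite 2 [← Real.rpow_one (1 - a)]
      rw [← Real.rpow_add h1]
      congr 1; push_cast; ring
    have e5 : (1 - a) ^ (α - 1 - α / 2) = (1 - a) ^ (α / 2 - 1) := by congr 1; ring
    simp only [foldPow, e1, e2, e3, e4, e5, Pi.pow_apply]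
    field_simp
    push_cast
    ring

lemma integral_foldPow_lt {α p η : ℝ} (hα : 0 < α) (hα2 : α < 2) (hp : α / 2 < p) (hpα : p < α)
    (hη : 0 < η) (hη4 : η ≤ 1 / 4) :
    (∫ a in Ioo (1 / 4 : ℝ) 1, (foldPow α p a - foldPow α (α / 2) a))
      + (α⁻¹ - α⁻¹ * η ^ (2 - α)) ≤ ∫ a in Ioo η 1, foldPow α p a := by
  have hη1 : η < 1 := by linarith
  have i1 := integrableOn_foldPow (p := p)  (by linarith) hpα hη hη1
  have i2 := integrableOn_foldPow (α := α) (p := α / 2)  (by linarith) (by linarith) hη hη1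
  have e := integral_foldPow_half hα hη hη1
  have h1 : ∫ a in Ioo (1 / 4 : ℝ) 1, (foldPow α p a - foldPow α (α / 2) a)
      ≤ ∫ a in Ioo η 1, (foldPow α p a - foldPow α (α / 2) a) := by
    refine setIntegral_mono_set (i1.sub i2) ?_ (LE.le.eventuallyLE (Ioo_subset_Ioo_left hη4))
    refine (ae_restrict_iff' measurableSet_Ioo).2 (ae_of_all _ fun a ha => ?_)
    exact sub_nonneg.2 (foldPow_half_lt hp ⟨hη.trans ha.1, ha.2⟩).le
  rw [integral_sub i1 i2, e] at h1
  have h2 : η ^ (-α) * (1 - (1 - η) ^ (α / 2)) ^ 2 ≤ η ^ (2 - α) := by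
    have l1 : 1 - η ≤ (1 - η) ^ (α / 2) := by
      conv_lhs => rw [← Real.rpow_one (1 - η)]
      exact Real.rpow_le_rpow_of_exponent_ge (by linarith) (by linarith) (by linarith)
    have l2 : (1 - η) ^ (α / 2) ≤ 1 := Real.rpow_le_one (by linarith) (by linarith) (by linarith)
    have : (1 - (1 - η) ^ (α / 2)) ^ 2 ≤ η ^ 2 := pow_le_pow_left₀ (by linarith) (by linarith) 2
    calc _ ≤ η ^ (-α) * η ^ 2 := mul_le_mul_of_nonneg_left this (Real.rpow_nonneg hη.le _)
      _ = η ^ (2 - α) := by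
        rw [← Real.rpow_natCast, ← Real.rpow_add hη]; congr 1; push_cast; ring
  have h3 := mul_le_mul_of_nonneg_left h2 (inv_nonneg.2 hα.le)
  linarith

lemma integral_foldPow_sub_half_pos {α p : ℝ} (hp : α / 2 < p)
    (hpα : p < α) :
    0 < ∫ a in Ioo (1 / 4 : ℝ) 1, (foldPow α p a - foldPow α (α / 2) a) := by
  have i1 := integrableOn_foldPow (p := p) (η := 1 / 4)  (by linarith) hpα (by norm_num) (by norm_num)
  have i2 := integrableOn_foldPow (α := α) (p := α / 2) (η := 1 / 4)  (by linarith) (by linarith)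
    (by norm_num) (by norm_num)
  have hpos : ∀ a ∈ Ioo (1 / 4 : ℝ) 1, 0 < foldPow α p a - foldPow α (α / 2) a := fun a ha =>
    sub_pos.2 (foldPow_half_lt hp ⟨by linarith [ha.1], ha.2⟩)
  rw [setIntegral_pos_iff_support_of_nonneg_ae
    ((ae_restrict_iff' measurableSet_Ioo).2 (ae_of_all _ fun a ha => (hpos a ha).le)) (i1.sub i2)]
  rw [inter_eq_self_of_subset_right
    (show Ioo (1 / 4 : ℝ) 1 ⊆ Function.support _ from fun a ha => (hpos a ha).ne')]
  simp
  norm_num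

lemma integral_one_add_rpow_sub_eq {α p η : ℝ} (hη : 0 < η) (hη1 : η < 1) :
    ∫ s in Ioi (η / (1 - η)), ((1 + s) ^ p - 1) * s ^ (-1 - α)
      = ∫ a in Ioo η 1, ((1 - a) ^ (α - 1 - p) - (1 - a) ^ (α - 1)) * a ^ (-1 - α) := by
  have himg : (fun a : ℝ => a / (1 - a)) '' Ioo η 1 = Ioi (η / (1 - η)) := by
    ext s
    simp only [mem_image, mem_Ioo, mem_Ioi]
    have hη' : 0 < 1 - η := by linarith
    constructor
    · rintro ⟨a, ⟨h1, h2⟩, rfl⟩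
      rw [div_lt_div_iff₀ hη' (by linarith)]
      nlinarith
    · intro hs
      have hs0 : 0 < s := lt_trans (by positivity) hs
      rw [div_lt_iff₀ hη'] at hs
      refine ⟨s / (1 + s), ⟨?_, ?_⟩, ?_⟩
      · rw [lt_div_iff₀ (by linarith)]; linarith
      · rw [div_lt_one (by linarith)]; linarith
      · field_simp; ring
  rw [← himg, integral_image_eq_integral_abs_deriv_smul measurableSet_Ioo
    (f' := fun a => 1 / (1 - a) ^ 2) ?_ ?_]
  · refine setIntegral_congr_fun measurableSet_Ioo fun a ha => ?_
    have h0 : 0 < a := hη.trans ha.1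
    have h1 : 0 < 1 - a := by linarith [ha.2]
    have e0 : 1 + a / (1 - a) = (1 - a)⁻¹ := by field_simp; ring
    have e1 : (1 - a) ^ (α - 1) = (1 - a) ^ (1 + α) * ((1 - a) ^ 2)⁻¹ := by
      rw [← Real.rpow_natCast, ← Real.rpow_neg h1.le, ← Real.rpow_add h1]
      congr 1; push_cast; ring
    have e2 : (1 - a) ^ (α - 1 - p) = (1 - a) ^ (1 + α) * ((1 - a) ^ 2)⁻¹ * ((1 - a) ^ p)⁻¹ := by
      rw [← e1, ← Real.rpow_neg h1.le, ← Real.rpow_add h1]; congr 1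
    rw [e0, Real.inv_rpow h1.le, Real.div_rpow h0.le h1.le, abs_of_pos (by positivity), smul_eq_mul,
      e1, e2, show -1 - α = -(1 + α) by ring, Real.rpow_neg h1.le (1 + α)]
    have := (Real.rpow_pos_of_pos h1 (1 + α)).ne'
    field_simp
  · intro a ha
    have h1 : 1 - a ≠ 0 := by linarith [ha.2]
    have := ((hasDerivAt_id a).div ((hasDerivAt_id a).const_sub 1) h1)
    refine (this.congr_deriv ?_).hasDerivWithinAt
    simp
  · intro a ha b hb hab
    have h1 : 1 - a ≠ 0 := by linarith [ha.2]
    have h2 : 1 - b ≠ 0 := by linarith [hb.2]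
    rw [div_eq_div_iff h1 h2] at hab
    linarith

lemma integral_posPowDiff_Ioi_ge {α p η : ℝ} (hα2 : α < 2) (hp0 : 0 < p)
    (hpα : p < α) (hη : 0 < η) (hη1 : η < 1) :
    (∫ a in Ioo η 1, foldPow α p a) - α⁻¹ ≤ ∫ s in Ioi η, posPowDiff p s * s ^ (-1 - α) := by
  have hηle : η ≤ η / (1 - η) := by
    rw [le_div_iff₀ (by linarith)]; nlinarith
  have hp2 : p ≤ 2 := by linarith
  have itail : IntegrableOn (fun s : ℝ => s ^ (-1 - α)) (Ioi η) :=
    integrableOn_Ioi_rpow_of_lt (by linarith) hη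
  have iφ : IntegrableOn (fun s : ℝ => posPowDiff p s * s ^ (-1 - α)) (Ioi η) :=
    (integrableOn_posPowDiff_mul_rpow hα2 hp0.le hp2 hpα).mono_set (Ioi_subset_Ioi hη.le)
  have iN : IntegrableOn (fun s : ℝ => (max (1 - s) 0 ^ p - 1) * s ^ (-1 - α)) (Ioi η) := by
    refine Integrable.mono' itail (by fun_prop) ?_
    refine (ae_restrict_iff' measurableSet_Ioi).2 (ae_of_all _ fun t (ht : η < t) => ?_)
    have h1 : 0 ≤ t ^ (-1 - α) := Real.rpow_nonneg (by linarith) _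
    have h2 : 0 ≤ max (1 - t) 0 ^ p := by positivity
    have h3 : max (1 - t) 0 ^ p ≤ 1 :=
      Real.rpow_le_one (by positivity) (max_le (by linarith) zero_le_one) hp0.le
    rw [Real.norm_eq_abs, abs_mul, abs_of_nonneg h1]
    refine mul_le_of_le_one_left h1 (abs_le.2 ⟨by linarith, by linarith⟩)
  have iP : IntegrableOn (fun s : ℝ => ((1 + s) ^ p - 1) * s ^ (-1 - α)) (Ioi η) := by
    refine (iφ.sub iN).congr_fun (fun s (hs : η < s) => ?_) measurableSet_Ioi
    simp only [posPowDiff, Pi.sub_apply]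
    rw [max_eq_left (show (0 : ℝ) ≤ 1 + s by linarith)]
    ring
  have hsplit : ∫ s in Ioi η, posPowDiff p s * s ^ (-1 - α)
      = (∫ s in Ioi η, ((1 + s) ^ p - 1) * s ^ (-1 - α))
        + ∫ s in Ioi η, (max (1 - s) 0 ^ p - 1) * s ^ (-1 - α) := by
    rw [← integral_add iP iN]
    refine setIntegral_congr_fun measurableSet_Ioi fun s (hs : η < s) => ?_
    simp only [posPowDiff]
    rw [max_eq_left (show (0 : ℝ) ≤ 1 + s by linarith)]
    ring
  have hP : ∫ a in Ioo η 1, ((1 - a) ^ (α - 1 - p) - (1 - a) ^ (α - 1)) * a ^ (-1 - α)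
      ≤ ∫ s in Ioi η, ((1 + s) ^ p - 1) * s ^ (-1 - α) := by
    rw [← integral_one_add_rpow_sub_eq hη hη1]
    refine setIntegral_mono_set iP ?_ (LE.le.eventuallyLE (Ioi_subset_Ioi hηle))
    refine (ae_restrict_iff' measurableSet_Ioi).2 (ae_of_all _ fun s (hs : η < s) => ?_)
    exact mul_nonneg (sub_nonneg.2 (Real.one_le_rpow (by linarith) hp0.le))
      (Real.rpow_nonneg (by linarith) _)
  have iN1 := iN.mono_set (Ioo_subset_Ioi_self : Ioo η 1 ⊆ Ioi η)
  have hN : ∫ s in Ioi η, (max (1 - s) 0 ^ p - 1) * s ^ (-1 - α)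
      = (∫ a in Ioo η 1, ((1 - a) ^ p - 1) * a ^ (-1 - α)) - α⁻¹ := by
    have hdisj : Disjoint (Ioo η 1) (Ici (1 : ℝ)) :=
      disjoint_left.2 fun x hx hx' => absurd hx.2 (not_lt.2 hx')
    rw [← Ioo_union_Ici_eq_Ioi hη1, setIntegral_union hdisj measurableSet_Ici iN1
      (iN.mono_set (Ici_subset_Ioi.2 hη1)), sub_eq_add_neg _ α⁻¹]
    congr 1
    · refine setIntegral_congr_fun measurableSet_Ioo fun s hs => ?_
      rw [max_eq_left (by linarith [hs.2])]
    · rw [integral_Ici_eq_integral_Ioi]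
      have : ∫ s in Ioi (1 : ℝ), (max (1 - s) 0 ^ p - 1) * s ^ (-1 - α)
          = ∫ s in Ioi (1 : ℝ), -s ^ (-1 - α) := by
        refine setIntegral_congr_fun measurableSet_Ioi fun s (hs : 1 < s) => ?_
        rw [max_eq_right (by linarith), Real.zero_rpow hp0.ne']
        ring
      rw [this, integral_neg, integral_Ioi_rpow_of_lt (by linarith) one_pos, Real.one_rpow,
        show -1 - α + 1 = -α by ring, neg_div_neg_eq, one_div]
  have iQ : IntegrableOn (fun a : ℝ => ((1 - a) ^ p - 1) * a ^ (-1 - α)) (Ioo η 1) := by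
    refine iN1.congr_fun (fun s hs => ?_) measurableSet_Ioo
    dsimp only
    rw [max_eq_left (by linarith [hs.2])]
  have iR : IntegrableOn
      (fun a : ℝ => ((1 - a) ^ (α - 1 - p) - (1 - a) ^ (α - 1)) * a ^ (-1 - α)) (Ioo η 1) := by
    refine ((integrableOn_foldPow hp0 hpα hη hη1).sub iQ).congr_fun (fun s hs => ?_)
      measurableSet_Ioo
    simp only [foldPow, Pi.sub_apply]
    ring
  have hfold : ∫ a in Ioo η 1, foldPow α p a
      = (∫ a in Ioo η 1, ((1 - a) ^ p - 1) * a ^ (-1 - α))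
        + ∫ a in Ioo η 1, ((1 - a) ^ (α - 1 - p) - (1 - a) ^ (α - 1)) * a ^ (-1 - α) := by
    rw [← integral_add iQ iR]
    refine setIntegral_congr_fun measurableSet_Ioo fun s _ => ?_
    simp only [foldPow]
    ring
  linarith

/-- The one-dimensional fractional Laplacian of `t ↦ t₊ ^ p` at `1` is positive
for `α / 2 < p < α`. -/
lemma integral_posPowDiff_mul_rpow_pos {α p : ℝ} (hα : 0 < α) (hα2 : α < 2) (hp : α / 2 < p)
    (hpα : p < α) : 0 < ∫ s in Ioi (0 : ℝ), posPowDiff p s * s ^ (-1 - α) := by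
  have hp0 : 0 < p := by linarith
  have hint := integrableOn_posPowDiff_mul_rpow hα2 hp0.le (by linarith : p ≤ 2) hpα
  have hpos := integral_foldPow_sub_half_pos hp hpα
  set c := ∫ a in Ioo (1 / 4 : ℝ) 1, (foldPow α p a - foldPow α (α / 2) a)
  refine hpos.trans_le ?_
  have hη : Tendsto (fun n : ℕ => 1 / ((n : ℝ) + 1)) atTop (nhds 0) :=
    tendsto_one_div_add_atTop_nhds_zero_nat
  have hU : ⋃ n : ℕ, Ioi (1 / ((n : ℝ) + 1)) = Ioi 0 := by
    ext x
    simp only [mem_iUnion, mem_Ioi]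
    exact ⟨fun ⟨n, hn⟩ => lt_trans (by positivity) hn, fun hx => exists_nat_one_div_lt hx⟩
  have lim1 : Tendsto (fun n : ℕ => ∫ s in Ioi (1 / ((n : ℝ) + 1)), posPowDiff p s * s ^ (-1 - α))
      atTop (nhds (∫ s in Ioi (0 : ℝ), posPowDiff p s * s ^ (-1 - α))) := by
    rw [← hU]
    refine tendsto_setIntegral_of_monotone (fun _ => measurableSet_Ioi) ?_ (by rwa [hU])
    intro m n hmn
    refine Ioi_subset_Ioi ?_
    exact one_div_le_one_div_of_le (by positivity) (by gcongr)
  have lim2 : Tendsto (fun n : ℕ => c - α⁻¹ * (1 / ((n : ℝ) + 1)) ^ (2 - α)) atTop (nhds c) := by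
    have := (hη.rpow_const (p := 2 - α) (Or.inr (by linarith))).const_mul α⁻¹
    rw [Real.zero_rpow (by linarith), mul_zero] at this
    simpa using this.const_sub c
  refine le_of_tendsto_of_tendsto lim2 lim1 ?_
  filter_upwards [eventually_ge_atTop 3] with n hn
  have hn' : (3 : ℝ) ≤ n := by exact_mod_cast hn
  have h4 : 1 / ((n : ℝ) + 1) ≤ 1 / 4 := one_div_le_one_div_of_le (by norm_num) (by linarith)
  have h0 : 0 < 1 / ((n : ℝ) + 1) := by positivity
  have k1 := integral_foldPow_lt hα hα2 hp hpα h0 h4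
  have k2 := integral_posPowDiff_Ioi_ge hα2 hp0 hpα h0 (by linarith)
  linarith

section EuclideanNorm

variable {m : ℕ}

instance isAddHaarMeasure_volume_prod_real :
    (volume : Measure (EuclideanSpace ℝ (Fin m) × ℝ)).IsAddHaarMeasure :=
  inferInstanceAs
    ((volume : Measure (EuclideanSpace ℝ (Fin m))).prod (volume : Measure ℝ)).IsAddHaarMeasure

lemma enorm'_eq_norm_toLp (z : EuclideanSpace ℝ (Fin m) × ℝ) : enorm' z = ‖WithLp.toLp 2 z‖ := by
  rw [WithLp.prod_norm_eq_of_L2, enorm', Real.norm_eq_abs, sq_abs, WithLp.toLp_fst, WithLp.toLp_snd]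

lemma continuous_enorm' :
    Continuous (enorm' : EuclideanSpace ℝ (Fin m) × ℝ → ℝ) := by
  unfold enorm'; fun_prop

@[fun_prop]
lemma measurable_enorm' : Measurable (enorm' : EuclideanSpace ℝ (Fin m) × ℝ → ℝ) :=
  continuous_enorm'.measurable

lemma enorm'_nonneg (z : EuclideanSpace ℝ (Fin m) × ℝ) : 0 ≤ enorm' z := Real.sqrt_nonneg _

lemma enorm'_neg (z : EuclideanSpace ℝ (Fin m) × ℝ) : enorm' (-z) = enorm' z := by
  simp [enorm']

lemma enorm'_smul (c : ℝ) (z : EuclideanSpace ℝ (Fin m) × ℝ) :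
    enorm' (c • z) = |c| * enorm' z := by
  rw [enorm'_eq_norm_toLp, enorm'_eq_norm_toLp, WithLp.toLp_smul, norm_smul, Real.norm_eq_abs]

lemma enorm'_add_le (z w : EuclideanSpace ℝ (Fin m) × ℝ) :
    enorm' (z + w) ≤ enorm' z + enorm' w := by
  simp only [enorm'_eq_norm_toLp, WithLp.toLp_add]
  exact norm_add_le _ _

lemma norm_le_enorm' (z : EuclideanSpace ℝ (Fin m) × ℝ) : ‖z‖ ≤ enorm' z := by
  rw [Prod.norm_def]
  refine max_le (Real.le_sqrt_of_sq_le (by nlinarith [sq_nonneg z.2])) (Real.le_sqrt_of_sq_le ?_)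
  rw [Real.norm_eq_abs, sq_abs]
  nlinarith [sq_nonneg ‖z.1‖]

lemma enorm'_le_add (z : EuclideanSpace ℝ (Fin m) × ℝ) : enorm' z ≤ ‖z.1‖ + |z.2| := by
  refine Real.sqrt_le_iff.2 ⟨by positivity, ?_⟩
  nlinarith [mul_nonneg (norm_nonneg z.1) (abs_nonneg z.2), sq_abs z.2]

lemma enorm'_le_two_mul_norm (z : EuclideanSpace ℝ (Fin m) × ℝ) : enorm' z ≤ 2 * ‖z‖ := by
  have h1 := norm_fst_le z
  have h2 := norm_snd_le z
  rw [Real.norm_eq_abs] at h2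
  linarith [enorm'_le_add z]

lemma abs_inner_add_le {n : EuclideanSpace ℝ (Fin m)} (hn : ‖n‖ ≤ 1)
    (z : EuclideanSpace ℝ (Fin m) × ℝ) : |inner ℝ n z.1 + z.2| ≤ 2 * ‖z‖ := by
  have h1 := norm_fst_le z
  have h2 := norm_snd_le z
  rw [Real.norm_eq_abs] at h2
  have h3 : |inner ℝ n z.1| ≤ 1 * ‖z.1‖ :=
    (abs_real_inner_le_norm n z.1).trans (mul_le_mul_of_nonneg_right hn (norm_nonneg _))
  linarith [abs_add_le (inner ℝ n z.1) z.2]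

variable {p α N : ℝ}

lemma integrable_minPow_div (hα0 : 0 < α) (hα2 : α < 2) (hp2 : p ≤ 2) (hpα : p < α)
    (hN : N = m + 1 + α) :
    Integrable (fun z : EuclideanSpace ℝ (Fin m) × ℝ => minPow p ‖z‖ / enorm' z ^ N) := by
  have hN0 : 0 ≤ N := by rw [hN]; positivity
  have h1 : Integrable (fun z : EuclideanSpace ℝ (Fin m) × ℝ => minPow p ‖z‖ / ‖z‖ ^ N) := by
    refine (integrable_fun_norm_addHaar volume (f := fun t => minPow p t / t ^ N)).2 ?_
    refine (integrableOn_minPow_mul_rpow hα2 hp2 hpα).congr_fun (fun t (ht : 0 < t) => ?_)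
      measurableSet_Ioi
    have hdim : Module.finrank ℝ (EuclideanSpace ℝ (Fin m) × ℝ) - 1 = m := by simp
    rw [hdim, smul_eq_mul, div_eq_mul_inv, ← Real.rpow_neg ht.le, mul_left_comm,
      ← Real.rpow_natCast, ← Real.rpow_add ht, hN]
    ring_nf
  refine h1.mono' (((measurable_minPow p).comp measurable_norm).div
    (measurable_enorm'.pow_const N)).aestronglyMeasurable (ae_of_all _ fun z => ?_)
  have h0 := minPow_nonneg p (norm_nonneg z)
  have h2 : 0 ≤ enorm' z ^ N := Real.rpow_nonneg (enorm'_nonneg z) N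
  rw [Real.norm_eq_abs, abs_of_nonneg (div_nonneg h0 h2)]
  rcases eq_or_ne z 0 with rfl | hz
  · simp [enorm']
  · have : 0 < ‖z‖ := norm_pos_iff.2 hz
    exact div_le_div_of_nonneg_left h0 (Real.rpow_pos_of_pos this N)
      (Real.rpow_le_rpow this.le (norm_le_enorm' z) hN0)

lemma div_enorm'_rpow_eq (f : EuclideanSpace ℝ (Fin m) × ℝ → ℝ) {ρ : ℝ} (hρ : 0 < ρ)
    (z : EuclideanSpace ℝ (Fin m) × ℝ) :
    f (ρ⁻¹ • z) / enorm' z ^ N = ρ ^ (-N) * (f (ρ⁻¹ • z) / enorm' (ρ⁻¹ • z) ^ N) := by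
  rw [enorm'_smul, abs_of_pos (inv_pos.2 hρ), Real.mul_rpow (inv_pos.2 hρ).le (enorm'_nonneg z),
    Real.inv_rpow hρ.le, Real.rpow_neg hρ.le]
  have := (Real.rpow_pos_of_pos hρ N).ne'
  rw [mul_comm ((ρ ^ N)⁻¹) (enorm' z ^ N), ← div_div, div_inv_eq_mul]
  field_simp

lemma integrable_comp_inv_smul_div {f : EuclideanSpace ℝ (Fin m) × ℝ → ℝ} {ρ : ℝ} (hρ : 0 < ρ)
    (hf : Integrable fun w => f w / enorm' w ^ N) :
    Integrable fun z => f (ρ⁻¹ • z) / enorm' z ^ N := by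
  simp_rw [div_enorm'_rpow_eq f hρ]
  exact (hf.comp_smul (inv_pos.2 hρ).ne').const_mul _

lemma integral_comp_inv_smul_div (hN : N = m + 1 + α)
    (f : EuclideanSpace ℝ (Fin m) × ℝ → ℝ) {ρ : ℝ} (hρ : 0 < ρ) :
    ∫ z, f (ρ⁻¹ • z) / enorm' z ^ N = ρ ^ (-α) * ∫ w, f w / enorm' w ^ N := by
  simp_rw [div_enorm'_rpow_eq f hρ]
  rw [integral_const_mul, Measure.integral_comp_inv_smul volume (fun w => f w / enorm' w ^ N) ρ,
    smul_eq_mul, ← mul_assoc, abs_of_pos (by positivity)]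
  congr 1
  have hdim : Module.finrank ℝ (EuclideanSpace ℝ (Fin m) × ℝ) = m + 1 := by simp
  rw [hdim, ← Real.rpow_natCast, ← Real.rpow_add hρ, hN]
  congr 1; push_cast; ring

lemma exists_forall_integral_indicator_minPow_le (hα0 : 0 < α) (hα2 : α < 2) (hp2 : p ≤ 2)
    (hpα : p < α) (hN : N = m + 1 + α) {ε : ℝ} (hε : 0 < ε) :
    ∃ R₀ > 0, ∀ R ≥ R₀, ∫ z : EuclideanSpace ℝ (Fin m) × ℝ,
      {w | R < ‖w‖}.indicator (fun w => minPow p ‖w‖) z / enorm' z ^ N ≤ ε := by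
  have hint := integrable_minPow_div (m := m) hα0 hα2 hp2 hpα hN
  have hms : ∀ R : ℝ, MeasurableSet {w : EuclideanSpace ℝ (Fin m) × ℝ | R < ‖w‖} := fun R =>
    measurableSet_lt measurable_const measurable_norm
  have hlim := tendsto_setIntegral_of_antitone (μ := volume) (ι := ℝ) hms
    (fun a b hab w (hw : b < ‖w‖) => lt_of_le_of_lt hab hw) ⟨0, hint.integrableOn⟩
  have hempty : ⋂ R : ℝ, {w : EuclideanSpace ℝ (Fin m) × ℝ | R < ‖w‖} = ∅ := by
    ext w
    simp only [mem_iInter, mem_ofPred_eq, mem_empty_iff_false, iff_false, not_forall, not_lt]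
    exact ⟨‖w‖, le_rfl⟩
  rw [hempty, setIntegral_empty] at hlim
  obtain ⟨R₀, hR₀⟩ := eventually_atTop.1 ((hlim.eventually (ge_mem_nhds hε)))
  refine ⟨max R₀ 1, by positivity, fun R hR => ?_⟩
  refine le_trans (le_of_eq ?_) (hR₀ R ((le_max_left _ _).trans hR))
  rw [← integral_indicator (hms R)]
  refine integral_congr_ae (ae_of_all _ fun z => ?_)
  simp only [indicator]
  split_ifs <;> simp

end EuclideanNorm

section HalfSpace

variable {m : ℕ} {p α N : ℝ}

lemma integrable_posPowDiff_inner_div (hα0 : 0 < α) (hα2 : α < 2) (hp0 : 0 ≤ p) (hp2 : p ≤ 2)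
    (hpα : p < α) (hN : N = m + 1 + α) {n : EuclideanSpace ℝ (Fin m)} (hn : ‖n‖ ≤ 1) :
    Integrable (fun w : EuclideanSpace ℝ (Fin m) × ℝ =>
      posPowDiff p (inner ℝ n w.1 + w.2) / enorm' w ^ N) := by
  have hmeas : Measurable fun w : EuclideanSpace ℝ (Fin m) × ℝ => inner ℝ n w.1 + w.2 := by fun_prop
  refine ((integrable_minPow_div (m := m) hα0 hα2 hp2 hpα hN).const_mul 2048).mono'
    (((measurable_posPowDiff p).comp hmeas).div
      (measurable_enorm'.pow_const N)).aestronglyMeasurable (ae_of_all _ fun w => ?_)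
  have h2 : 0 ≤ enorm' w ^ N := Real.rpow_nonneg (enorm'_nonneg w) N
  rw [Real.norm_eq_abs, abs_div, abs_of_nonneg h2, ← mul_div_assoc]
  exact div_le_div_of_nonneg_right (abs_posPowDiff_le hp0 hp2 (abs_inner_add_le hn w)) h2

lemma measurePreserving_sub_inner (n : EuclideanSpace ℝ (Fin m)) :
    MeasurePreserving (fun w : EuclideanSpace ℝ (Fin m) × ℝ => (w.1, w.2 - inner ℝ n w.1)) := by
  refine (MeasurePreserving.id volume).skew_product
    (g := fun (v : EuclideanSpace ℝ (Fin m)) (t : ℝ) => t - inner ℝ n v) (by fun_prop) ?_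
  exact ae_of_all _ fun v => (measurePreserving_sub_right volume (inner ℝ n v : ℝ)).map_eq

/-- The total mass of the kernel `|z| ^ (-N)` over the hyperplane `⟨(n, 1), z⟩ = 1`. -/
noncomputable def sliceMass (N : ℝ) (n : EuclideanSpace ℝ (Fin m)) : ℝ :=
  ∫ u : EuclideanSpace ℝ (Fin m), (enorm' (u, 1 - inner ℝ n u) ^ N)⁻¹

lemma integral_slice_eq (hN : N = m + 1 + α) (n : EuclideanSpace ℝ (Fin m)) {t : ℝ} (ht : t ≠ 0) :
    ∫ v : EuclideanSpace ℝ (Fin m), (enorm' (v, t - inner ℝ n v) ^ N)⁻¹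
      = |t| ^ (-1 - α) * sliceMass N n := by
  have ht0 : 0 < |t| := abs_pos.2 ht
  have h1 := Measure.integral_comp_smul (volume : Measure (EuclideanSpace ℝ (Fin m)))
    (fun v => (enorm' (v, t - inner ℝ n v) ^ N)⁻¹) t
  have h2 : ∀ v : EuclideanSpace ℝ (Fin m), (enorm' (t • v, t - inner ℝ n (t • v)) ^ N)⁻¹
      = |t| ^ (-N) * (enorm' (v, 1 - inner ℝ n v) ^ N)⁻¹ := by
    intro v
    have : (t • v, t - inner ℝ n (t • v)) = t • (v, 1 - (inner ℝ n v : ℝ)) := by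
      rw [Prod.smul_mk, inner_smul_right, smul_eq_mul]; ring_nf
    rw [this, enorm'_smul, Real.mul_rpow ht0.le (enorm'_nonneg _), mul_inv, Real.rpow_neg ht0.le]
  simp_rw [h2] at h1
  rw [integral_const_mul, finrank_euclideanSpace_fin, smul_eq_mul, abs_inv, abs_pow] at h1
  have h3 : |t| ^ (-1 - α) = |t| ^ m * |t| ^ (-N) := by
    rw [← Real.rpow_natCast, ← Real.rpow_add ht0, hN]; congr 1; ring
  have h4 : |t| ^ m ≠ 0 := (pow_pos ht0 m).ne'
  rw [h3, mul_assoc, sliceMass, h1, mul_inv_cancel_left₀ h4]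

lemma exists_pos_le_sliceMass (hα0 : 0 < α) (hN : N = m + 1 + α) :
    ∃ c > 0, ∀ n : EuclideanSpace ℝ (Fin m), ‖n‖ ≤ 1 → c ≤ sliceMass N n := by
  have hN0 : 0 ≤ N := by rw [hN]; positivity
  have hint : Integrable fun u : EuclideanSpace ℝ (Fin m) => (1 + ‖u‖) ^ (-N) :=
    integrable_one_add_norm (by rw [finrank_euclideanSpace_fin, hN]; linarith)
  have hpos : ∀ u : EuclideanSpace ℝ (Fin m), 0 < (1 + ‖u‖) ^ (-N) := fun u =>
    Real.rpow_pos_of_pos (by positivity) _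
  refine ⟨2 ^ (-N) * ∫ u : EuclideanSpace ℝ (Fin m), (1 + ‖u‖) ^ (-N), ?_, fun n hn => ?_⟩
  · refine mul_pos (by positivity) ?_
    rw [integral_pos_iff_support_of_nonneg (fun u => (hpos u).le) hint]
    rw [show (Function.support fun u : EuclideanSpace ℝ (Fin m) => (1 + ‖u‖) ^ (-N)) = univ from
      eq_univ_of_forall fun u => (hpos u).ne']
    exact Measure.measure_univ_pos.2 (NeZero.ne _)
  have hle : ∀ u : EuclideanSpace ℝ (Fin m), |inner ℝ n u| ≤ ‖u‖ := fun u =>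
    (abs_real_inner_le_norm n u).trans (mul_le_of_le_one_left (norm_nonneg _) hn)
  have hlow : ∀ u : EuclideanSpace ℝ (Fin m), 3⁻¹ * (1 + ‖u‖) ≤ enorm' (u, 1 - inner ℝ n u) := by
    intro u
    have h := norm_le_enorm' (u, 1 - (inner ℝ n u : ℝ))
    have h1 := (norm_fst_le (u, 1 - (inner ℝ n u : ℝ))).trans h
    have h2 := (norm_snd_le (u, 1 - (inner ℝ n u : ℝ))).trans h
    have h3 := (le_abs_self _).trans h2
    have h4 := (le_abs_self _).trans (hle u)
    simp only at h1 h3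
    linarith
  have hupp : ∀ u : EuclideanSpace ℝ (Fin m), enorm' (u, 1 - inner ℝ n u) ≤ 2 * (1 + ‖u‖) := by
    intro u
    have h := enorm'_le_add (u, 1 - (inner ℝ n u : ℝ))
    have h1 : |1 - (inner ℝ n u : ℝ)| ≤ 1 + ‖u‖ :=
      (abs_sub _ _).trans (by rw [abs_one]; linarith [hle u])
    simp only at h
    linarith
  rw [sliceMass, ← integral_const_mul]
  refine integral_mono (hint.const_mul _) ?_ fun u => ?_
  · refine (hint.const_mul (3⁻¹ ^ (-N))).mono' ?_ (ae_of_all _ fun u => ?_)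
    · have : Measurable fun u : EuclideanSpace ℝ (Fin m) => (u, 1 - (inner ℝ n u : ℝ)) := by fun_prop
      exact ((measurable_enorm'.comp this).pow_const N).inv.aestronglyMeasurable
    · rw [Real.norm_eq_abs, abs_of_nonneg (inv_nonneg.2 (Real.rpow_nonneg (enorm'_nonneg _) N)),
        ← Real.mul_rpow (by norm_num) (by positivity), ← Real.rpow_neg (enorm'_nonneg _)]
      exact Real.rpow_le_rpow_of_nonpos (by positivity) (hlow u) (by linarith)
  · simp only
    rw [← Real.mul_rpow (by norm_num) (by positivity), ← Real.rpow_neg (enorm'_nonneg _)]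
    have : 0 < 3⁻¹ * (1 + ‖u‖) := by positivity
    exact Real.rpow_le_rpow_of_nonpos (this.trans_le (hlow u)) (hupp u) (by linarith)

/-- The fractional Laplacian of the `p`-th power of a linear function `⟨(n, 1), ·⟩` factors
through the one-dimensional one. -/
lemma integral_posPowDiff_inner_div (hα0 : 0 < α) (hα2 : α < 2) (hp0 : 0 ≤ p) (hp2 : p ≤ 2)
    (hpα : p < α) (hN : N = m + 1 + α) {n : EuclideanSpace ℝ (Fin m)} (hn : ‖n‖ ≤ 1) :
    ∫ w : EuclideanSpace ℝ (Fin m) × ℝ, posPowDiff p (inner ℝ n w.1 + w.2) / enorm' w ^ N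
      = sliceMass N n * (2 * ∫ s in Ioi (0 : ℝ), posPowDiff p s * s ^ (-1 - α)) := by
  have hint := integrable_posPowDiff_inner_div hα0 hα2 hp0 hp2 hpα hN hn
  have hmp := measurePreserving_sub_inner n
  have hmap := hmp.map_eq
  have hint' := hmp.integrable_comp_of_integrable hint
  rw [← hmap, integral_map hmp.aemeasurable (by rw [hmap]; exact hint.aestronglyMeasurable)]
  refine (integral_prod_symm _ hint').trans ?_
  rw [← integral_comp_abs, ← integral_const_mul]
  refine integral_congr_ae ?_
  filter_upwards [Measure.ae_ne volume (0 : ℝ)] with t ht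
  simp only [Function.comp_apply, add_sub_cancel, div_eq_mul_inv]
  rw [integral_const_mul, integral_slice_eq hN n ht, posPowDiff_abs]
  ring

lemma exists_pos_le_integral_posPowDiff_inner_div (hα0 : 0 < α) (hα2 : α < 2) (hp : α / 2 < p)
    (hpα : p < α) (hN : N = m + 1 + α) :
    ∃ c > 0, ∀ n : EuclideanSpace ℝ (Fin m), ‖n‖ ≤ 1 →
      c ≤ ∫ w : EuclideanSpace ℝ (Fin m) × ℝ,
        posPowDiff p (inner ℝ n w.1 + w.2) / enorm' w ^ N := by
  obtain ⟨c, hc, hcn⟩ := exists_pos_le_sliceMass (m := m) hα0 hN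
  have hpos := integral_posPowDiff_mul_rpow_pos hα0 hα2 hp hpα
  refine ⟨c * (2 * ∫ s in Ioi (0 : ℝ), posPowDiff p s * s ^ (-1 - α)), by positivity, fun n hn => ?_⟩
  rw [integral_posPowDiff_inner_div hα0 hα2 (by linarith) (by linarith) hpα hN hn]
  exact mul_le_mul_of_nonneg_right (hcn n hn) (by positivity)

end HalfSpace

/-- The graph of `v ↦ √(r² - ‖v‖²)` lies below its tangent planes, at quadratic distance. -/
lemma sqrt_sub_norm_sq_tangent {V : Type*} [NormedAddCommGroup V] [InnerProductSpace ℝ V]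
    {r : ℝ} (hr : 0 < r) {v z : V} (hv : ‖v‖ < r / 4) (hvz : ‖v + z‖ < r / 2) :
    0 ≤ √(r ^ 2 - ‖v‖ ^ 2) - inner ℝ ((√(r ^ 2 - ‖v‖ ^ 2))⁻¹ • v) z - √(r ^ 2 - ‖v + z‖ ^ 2) ∧
      √(r ^ 2 - ‖v‖ ^ 2) - inner ℝ ((√(r ^ 2 - ‖v‖ ^ 2))⁻¹ • v) z - √(r ^ 2 - ‖v + z‖ ^ 2)
        ≤ 2 / r * ‖z‖ ^ 2 := by
  have hv0 := norm_nonneg v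
  have hvz0 := norm_nonneg (v + z)
  have hz0 := norm_nonneg z
  have hA2 : 0 ≤ r ^ 2 - ‖v‖ ^ 2 := by nlinarith
  have hB2 : 0 ≤ r ^ 2 - ‖v + z‖ ^ 2 := by nlinarith
  have hA : 9 / 10 * r ≤ √(r ^ 2 - ‖v‖ ^ 2) := Real.le_sqrt_of_sq_le (by nlinarith)
  have hB : 8 / 10 * r ≤ √(r ^ 2 - ‖v + z‖ ^ 2) := Real.le_sqrt_of_sq_le (by nlinarith)
  have eA := Real.sq_sqrt hA2
  have eB := Real.sq_sqrt hB2
  set A := √(r ^ 2 - ‖v‖ ^ 2)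
  set B := √(r ^ 2 - ‖v + z‖ ^ 2)
  have hA0 : 0 < A := by linarith [hr]
  have h1 := norm_add_sq_real v z
  rw [inner_smul_left, RCLike.conj_to_real]
  set i := (inner ℝ v z : ℝ)
  have hgap : A * (A - A⁻¹ * i - B) = (‖z‖ ^ 2 + (A - B) ^ 2) / 2 := by
    rw [show A * (A - A⁻¹ * i - B) = A ^ 2 - A * A⁻¹ * i - A * B by ring, mul_inv_cancel₀ hA0.ne']
    linarith
  have hAB : (A - B) ^ 2 ≤ ‖z‖ ^ 2 := by
    have t1 : |‖v + z‖ - ‖v‖| ≤ ‖z‖ := by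
      simpa using abs_norm_sub_norm_le (v + z) v
    have t2 : (A - B) * (A + B) = (‖v + z‖ - ‖v‖) * (‖v + z‖ + ‖v‖) := by
      linear_combination eA - eB
    have t3 : |A - B| * (A + B) = |‖v + z‖ - ‖v‖| * (‖v + z‖ + ‖v‖) := by
      have := congrArg abs t2
      rwa [abs_mul, abs_mul, abs_of_nonneg (by linarith : 0 ≤ A + B),
        abs_of_nonneg (by linarith : 0 ≤ ‖v + z‖ + ‖v‖)] at this
    have t4 : |A - B| * r ≤ ‖z‖ * r := by
      calc |A - B| * r ≤ |A - B| * (A + B) :=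
            mul_le_mul_of_nonneg_left (by linarith) (abs_nonneg _)
        _ ≤ ‖z‖ * r := by
            rw [t3]; exact mul_le_mul t1 (by linarith) (by linarith) hz0
    have t5 := le_of_mul_le_mul_right t4 hr
    rw [← sq_abs (A - B)]
    exact pow_le_pow_left₀ (abs_nonneg _) t5 2
  set E := A - A⁻¹ * i - B
  have hE0 : 0 ≤ E := by
    refine nonneg_of_mul_nonneg_right ?_ hA0
    rw [hgap]; positivity
  refine ⟨hE0, ?_⟩
  rw [div_mul_eq_mul_div, le_div_iff₀ hr]
  nlinarith

section Exterior

variable {d : ℕ} {r p : ℝ}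

lemma measurable_hfun (d : ℕ) (r p : ℝ) : Measurable (hfun d r p) := by
  refine Measurable.ite ?_ (by fun_prop) measurable_const
  refine (measurableSet_lt measurable_const measurable_enorm').inter
    ((measurableSet_lt measurable_enorm' measurable_const).inter
      ((measurableSet_lt measurable_const measurable_snd).inter
        (measurableSet_lt measurable_fst.norm measurable_const)))

lemma hfun_eq_max_rpow (hr : 0 < r) (hp : 0 < p) {w : EuclideanSpace ℝ (Fin (d - 1)) × ℝ}
    (hw : ‖w.1‖ < r / 2) (hw' : enorm' w < 3 * r / 2) :
    hfun d r p w = max (w.2 - √(r ^ 2 - ‖w.1‖ ^ 2)) 0 ^ p := by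
  have h0 := norm_nonneg w.1
  have hg : 0 ≤ r ^ 2 - ‖w.1‖ ^ 2 := by nlinarith
  have hg0 := Real.sqrt_nonneg (r ^ 2 - ‖w.1‖ ^ 2)
  unfold hfun
  split_ifs with h
  · rw [max_eq_left]
    obtain ⟨h1, -, h3, -⟩ := h
    rw [enorm', Real.lt_sqrt hr.le] at h1
    rw [sub_nonneg, Real.sqrt_le_left h3.le]
    linarith
  · rw [max_eq_right, Real.zero_rpow hp.ne']
    by_contra! hlt
    have h3 : √(r ^ 2 - ‖w.1‖ ^ 2) < w.2 := by linarith
    have h4 : 0 < w.2 := by linarith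
    refine h ⟨?_, hw', h4, hw⟩
    rw [enorm', Real.lt_sqrt hr.le]
    rw [Real.sqrt_lt' h4] at h3
    linarith

lemma hfun_nonneg (hr : 0 < r) (hp : 0 < p) (w : EuclideanSpace ℝ (Fin (d - 1)) × ℝ) :
    0 ≤ hfun d r p w := by
  by_cases h : ‖w.1‖ < r / 2 ∧ enorm' w < 3 * r / 2
  · rw [hfun_eq_max_rpow hr hp h.1 h.2]; positivity
  · rw [hfun, if_neg (fun h' => h ⟨h'.2.2.2, h'.2.1⟩)]

lemma hfun_le_max_rpow (hr : 0 < r) (hp : 0 < p) (w : EuclideanSpace ℝ (Fin (d - 1)) × ℝ) :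
    hfun d r p w ≤ max (w.2 - √(r ^ 2 - ‖w.1‖ ^ 2)) 0 ^ p := by
  by_cases h : ‖w.1‖ < r / 2 ∧ enorm' w < 3 * r / 2
  · rw [hfun_eq_max_rpow hr hp h.1 h.2]
  · rw [hfun, if_neg (fun h' => h ⟨h'.2.2.2, h'.2.1⟩)]; positivity

lemma hfun_le_const (hr : 0 < r) (hp : 0 < p) (w : EuclideanSpace ℝ (Fin (d - 1)) × ℝ) :
    hfun d r p w ≤ (3 * r / 2) ^ p := by
  by_cases h : ‖w.1‖ < r / 2 ∧ enorm' w < 3 * r / 2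
  · rw [hfun_eq_max_rpow hr hp h.1 h.2]
    refine Real.rpow_le_rpow (le_max_right _ _) (max_le ?_ (by positivity)) hp.le
    have h1 := (norm_snd_le w).trans (norm_le_enorm' w)
    have h2 := (le_abs_self w.2).trans h1
    linarith [Real.sqrt_nonneg (r ^ 2 - ‖w.1‖ ^ 2)]
  · rw [hfun, if_neg (fun h' => h ⟨h'.2.2.2, h'.2.1⟩)]; positivity

variable {y : EuclideanSpace ℝ (Fin (d - 1)) × ℝ} {ρ : ℝ}

lemma exists_height_eq (hr : 0 < r) (hy : ‖y.1‖ < r / 4)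
    (hρ : ρ = y.2 - √(r ^ 2 - ‖y.1‖ ^ 2)) (hρ0 : 0 < ρ) (hρr : ρ ≤ r / 2)
    {w : EuclideanSpace ℝ (Fin (d - 1)) × ℝ} (hw : ‖(y + ρ • w).1‖ < r / 2) :
    ∃ e, 0 ≤ e ∧ e ≤ ‖w‖ ^ 2 ∧ e ≤ 2 * ‖w‖ ∧
      (y + ρ • w).2 - √(r ^ 2 - ‖(y + ρ • w).1‖ ^ 2)
        = ρ * (1 + (inner ℝ ((√(r ^ 2 - ‖y.1‖ ^ 2))⁻¹ • y.1) w.1 + w.2) + e) := by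
  have hw1 := norm_fst_le w
  have hw0 := norm_nonneg w.1
  have e1 : (y + ρ • w).1 = y.1 + ρ • w.1 := rfl
  have e2 : (y + ρ • w).2 = y.2 + ρ * w.2 := rfl
  rw [e1] at hw
  have hz : ρ * ‖w.1‖ < 3 / 4 * r := by
    have h := norm_sub_le (y.1 + ρ • w.1) y.1
    rw [add_sub_cancel_left, norm_smul, Real.norm_eq_abs, abs_of_pos hρ0] at h
    linarith
  obtain ⟨h1, h2⟩ := sqrt_sub_norm_sq_tangent hr hy hw
  rw [e1, e2]
  rw [inner_smul_right, norm_smul, Real.norm_eq_abs, abs_of_pos hρ0] at h2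
  rw [inner_smul_right] at h1
  set g := √(r ^ 2 - ‖y.1‖ ^ 2)
  set i := (inner ℝ (g⁻¹ • y.1) w.1 : ℝ)
  set B := √(r ^ 2 - ‖y.1 + ρ • w.1‖ ^ 2)
  have h3 : (g - ρ * i - B) * r ≤ 2 * (ρ * ‖w.1‖) ^ 2 := by
    rwa [div_mul_eq_mul_div, le_div_iff₀ hr] at h2
  have h4 : g - ρ * i - B ≤ ρ * ‖w.1‖ ^ 2 := by
    refine le_of_mul_le_mul_right (h3.trans ?_) hr
    have : 0 ≤ ρ * ‖w.1‖ ^ 2 := by positivity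
    nlinarith
  have h5 : g - ρ * i - B ≤ ρ * (2 * ‖w.1‖) := by
    refine le_of_mul_le_mul_right (h3.trans ?_) hr
    have : 0 ≤ ρ * ‖w.1‖ := by positivity
    nlinarith
  refine ⟨(g - ρ * i - B) / ρ, div_nonneg h1 hρ0.le, ?_, ?_, ?_⟩
  · rw [div_le_iff₀ hρ0]
    have : ‖w.1‖ ^ 2 ≤ ‖w‖ ^ 2 := pow_le_pow_left₀ hw0 hw1 2
    nlinarith
  · rw [div_le_iff₀ hρ0]
    nlinarith
  · rw [mul_add ρ _ ((g - ρ * i - B) / ρ), mul_div_cancel₀ _ hρ0.ne']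
    linear_combination -hρ

lemma norm_inv_sqrt_smul_le (hr : 0 < r) (hy : ‖y.1‖ < r / 4) :
    ‖(√(r ^ 2 - ‖y.1‖ ^ 2))⁻¹ • y.1‖ ≤ 1 := by
  have h0 := norm_nonneg y.1
  have hA : r / 4 ≤ √(r ^ 2 - ‖y.1‖ ^ 2) := Real.le_sqrt_of_sq_le (by nlinarith)
  have hA0 : 0 < √(r ^ 2 - ‖y.1‖ ^ 2) := by linarith
  rw [norm_smul, norm_inv, Real.norm_eq_abs, abs_of_pos hA0, inv_mul_le_iff₀ hA0]
  linarith

lemma exists_hfun_eq (hr : 0 < r) (hp : 0 < p) (hy : ‖y.1‖ < r / 4) (hy' : enorm' y < 5 * r / 4)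
    (hρ : ρ = y.2 - √(r ^ 2 - ‖y.1‖ ^ 2)) (hρ0 : 0 < ρ) (hρr : ρ ≤ r / 2)
    {w : EuclideanSpace ℝ (Fin (d - 1)) × ℝ} (hw : ρ * ‖w‖ ≤ r / 8) :
    ∃ e, 0 ≤ e ∧ e ≤ ‖w‖ ^ 2 ∧ hfun d r p (y + ρ • w)
      = ρ ^ p * max (1 + (inner ℝ ((√(r ^ 2 - ‖y.1‖ ^ 2))⁻¹ • y.1) w.1 + w.2) + e) 0 ^ p := by
  have hw1 : ‖(y + ρ • w).1‖ < r / 2 := by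
    have h := norm_add_le y.1 (ρ • w.1)
    rw [norm_smul, Real.norm_eq_abs, abs_of_pos hρ0] at h
    have h2 := mul_le_mul_of_nonneg_left (norm_fst_le w) hρ0.le
    exact h.trans_lt (by linarith)
  have hw2 : enorm' (y + ρ • w) < 3 * r / 2 := by
    have h := enorm'_add_le y (ρ • w)
    rw [enorm'_smul, abs_of_pos hρ0] at h
    have h2 := mul_le_mul_of_nonneg_left (enorm'_le_two_mul_norm w) hρ0.le
    linarith
  obtain ⟨e, he0, he1, -, he⟩ := exists_height_eq hr hy hρ hρ0 hρr hw1
  refine ⟨e, he0, he1, ?_⟩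
  rw [hfun_eq_max_rpow hr hp hw1 hw2, he, ← Real.mul_rpow hρ0.le (le_max_right _ _),
    mul_max_of_nonneg _ _ hρ0.le, mul_zero]

lemma hfun_le (hr : 0 < r) (hp : 0 < p) (hy : ‖y.1‖ < r / 4)
    (hρ : ρ = y.2 - √(r ^ 2 - ‖y.1‖ ^ 2)) (hρ0 : 0 < ρ) (hρr : ρ ≤ r / 2)
    (w : EuclideanSpace ℝ (Fin (d - 1)) × ℝ) :
    hfun d r p (y + ρ • w) ≤ ρ ^ p * (1 + 4 * ‖w‖) ^ p := by
  by_cases hw1 : ‖(y + ρ • w).1‖ < r / 2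
  · obtain ⟨e, -, -, he1, he⟩ := exists_height_eq hr hy hρ hρ0 hρr hw1
    refine (hfun_le_max_rpow hr hp _).trans ?_
    rw [he, ← Real.mul_rpow hρ0.le (by positivity)]
    refine Real.rpow_le_rpow (le_max_right _ _) (max_le ?_ (by positivity)) hp.le
    have := (abs_le.1 (abs_inner_add_le (norm_inv_sqrt_smul_le hr hy) w)).2
    exact mul_le_mul_of_nonneg_left (by linarith) hρ0.le
  · rw [hfun, if_neg (fun h' => hw1 h'.2.2.2)]; positivity

lemma hfun_self (hr : 0 < r) (hp : 0 < p) (hy : ‖y.1‖ < r / 4) (hy' : enorm' y < 5 * r / 4)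
    (hρ : ρ = y.2 - √(r ^ 2 - ‖y.1‖ ^ 2)) (hρ0 : 0 < ρ) : hfun d r p y = ρ ^ p := by
  rw [hfun_eq_max_rpow hr hp (by linarith) (by linarith), ← hρ, max_eq_left hρ0.le]

lemma abs_hfun_secondDiff_le (hr : 0 < r) (hp : 0 < p) (hp2 : p ≤ 2) (hy : ‖y.1‖ < r / 4)
    (hy' : enorm' y < 5 * r / 4) (hρ : ρ = y.2 - √(r ^ 2 - ‖y.1‖ ^ 2)) (hρ0 : 0 < ρ)
    (hρr : ρ ≤ r / 2) (w : EuclideanSpace ℝ (Fin (d - 1)) × ℝ) :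
    |hfun d r p (y + ρ • w) + hfun d r p (y - ρ • w) - 2 * hfun d r p y|
      ≤ 2048 * ρ ^ p * minPow p ‖w‖ := by
  have hn := norm_inv_sqrt_smul_le hr hy
  have hs := abs_inner_add_le hn w
  have hρp : 0 < ρ ^ p := Real.rpow_pos_of_pos hρ0 p
  rw [hfun_self hr hp hy hy' hρ hρ0, sub_eq_add_neg y (ρ • w), ← smul_neg]
  rcases le_total ‖w‖ (1 / 4) with h | h
  · have hw : ρ * ‖w‖ ≤ r / 8 := by nlinarith [norm_nonneg w]
    obtain ⟨e₁, he₁, he₁', h₁⟩ := exists_hfun_eq hr hp hy hy' hρ hρ0 hρr hw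
    obtain ⟨e₂, he₂, he₂', h₂⟩ := exists_hfun_eq hr hp hy hy' hρ hρ0 hρr (w := -w) (by rwa [norm_neg])
    rw [norm_neg] at he₂'
    rw [h₁, h₂, Prod.fst_neg, Prod.snd_neg, inner_neg_right, ← neg_add, ← sub_eq_add_neg]
    set s := inner ℝ ((√(r ^ 2 - ‖y.1‖ ^ 2))⁻¹ • y.1) w.1 + w.2
    obtain ⟨hs1, hs2⟩ := abs_le.1 hs
    rw [max_eq_left (by linarith), max_eq_left (by linarith)]
    have := abs_rpow_add_rpow_sub_two_le hp.le hp2 (norm_nonneg w) h hs he₁ he₁' he₂ he₂'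
    rw [show ∀ a b : ℝ, ρ ^ p * a + ρ ^ p * b - 2 * ρ ^ p = ρ ^ p * (a + b - 2) by intros; ring,
      abs_mul, abs_of_pos hρp, minPow_of_le_one hp2 (norm_nonneg w) (by linarith)]
    nlinarith [mul_le_mul_of_nonneg_left this hρp.le, mul_nonneg hρp.le (sq_nonneg ‖w‖)]
  · have key : ∀ v : EuclideanSpace ℝ (Fin (d - 1)) × ℝ, ‖v‖ = ‖w‖ →
        ∃ a, 0 ≤ a ∧ a ≤ (8 * ‖w‖) ^ p ∧ hfun d r p (y + ρ • v) = ρ ^ p * a := by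
      intro v hv
      refine ⟨hfun d r p (y + ρ • v) / ρ ^ p, div_nonneg (hfun_nonneg hr hp _) hρp.le, ?_, ?_⟩
      · rw [div_le_iff₀ hρp, mul_comm]
        refine (hfun_le hr hp hy hρ hρ0 hρr v).trans (mul_le_mul_of_nonneg_left ?_ hρp.le)
        rw [hv]
        exact Real.rpow_le_rpow (by positivity) (by linarith) hp.le
      · rw [mul_div_cancel₀ _ hρp.ne']
    obtain ⟨a, ha, ha', h₁⟩ := key w rfl
    obtain ⟨b, hb, hb', h₂⟩ := key (-w) (norm_neg w)
    have := abs_add_sub_two_le hp.le hp2 h ha ha' hb hb'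
    rw [h₁, h₂, show ρ ^ p * a + ρ ^ p * b - 2 * ρ ^ p = ρ ^ p * (a + b - 2) by ring,
      abs_mul, abs_of_pos hρp]
    nlinarith [mul_le_mul_of_nonneg_left this hρp.le]

lemma posPowDiff_le_hfun_secondDiff (hr : 0 < r) (hp : 0 < p) (hy : ‖y.1‖ < r / 4)
    (hy' : enorm' y < 5 * r / 4) (hρ : ρ = y.2 - √(r ^ 2 - ‖y.1‖ ^ 2)) (hρ0 : 0 < ρ)
    (hρr : ρ ≤ r / 2) {w : EuclideanSpace ℝ (Fin (d - 1)) × ℝ} (hw : ρ * ‖w‖ ≤ r / 8) :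
    ρ ^ p * posPowDiff p (inner ℝ ((√(r ^ 2 - ‖y.1‖ ^ 2))⁻¹ • y.1) w.1 + w.2)
      ≤ hfun d r p (y + ρ • w) + hfun d r p (y - ρ • w) - 2 * hfun d r p y := by
  have hρp : 0 < ρ ^ p := Real.rpow_pos_of_pos hρ0 p
  rw [hfun_self hr hp hy hy' hρ hρ0, sub_eq_add_neg y (ρ • w), ← smul_neg]
  obtain ⟨e₁, he₁, -, h₁⟩ := exists_hfun_eq hr hp hy hy' hρ hρ0 hρr hw
  obtain ⟨e₂, he₂, -, h₂⟩ := exists_hfun_eq hr hp hy hy' hρ hρ0 hρr (w := -w) (by rwa [norm_neg])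
  rw [h₁, h₂, Prod.fst_neg, Prod.snd_neg, inner_neg_right, ← neg_add, ← sub_eq_add_neg]
  set s := inner ℝ ((√(r ^ 2 - ‖y.1‖ ^ 2))⁻¹ • y.1) w.1 + w.2
  have k1 : max (1 + s) 0 ^ p ≤ max (1 + s + e₁) 0 ^ p :=
    Real.rpow_le_rpow (le_max_right _ _) (max_le_max_right 0 (by linarith)) hp.le
  have k2 : max (1 - s) 0 ^ p ≤ max (1 - s + e₂) 0 ^ p :=
    Real.rpow_le_rpow (le_max_right _ _) (max_le_max_right 0 (by linarith)) hp.le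
  unfold posPowDiff
  nlinarith

end Exterior

section PrincipalValue

variable {d : ℕ} {α M : ℝ} {u : EuclideanSpace ℝ (Fin (d - 1)) × ℝ → ℝ}

lemma measurableSet_enorm'_Ioc {m : ℕ} (a b : ℝ) :
    MeasurableSet {z : EuclideanSpace ℝ (Fin m) × ℝ | a < enorm' z ∧ enorm' z ≤ b} :=
  (measurableSet_lt measurable_const measurable_enorm').inter
    (measurableSet_le measurable_enorm' measurable_const)

lemma integrable_indicator_sub_div (hα : 0 < α) (hu : Measurable u) (hM : ∀ z, |u z| ≤ M)
    (x : EuclideanSpace ℝ (Fin (d - 1)) × ℝ) {ε : ℝ} (hε : 0 < ε) :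
    Integrable ({z : EuclideanSpace ℝ (Fin (d - 1)) × ℝ | ε < enorm' z ∧ enorm' z ≤ 1}.indicator
      fun z => (u (x + z) - u x) / enorm' z ^ ((d : ℝ) + α)) := by
  rw [integrable_indicator_iff (measurableSet_enorm'_Ioc ε 1)]
  have hN : 0 ≤ (d : ℝ) + α := by positivity
  refine Measure.integrableOn_of_bounded (M := 2 * M / ε ^ ((d : ℝ) + α)) ?_ ?_ ?_
  · refine ((measure_mono ?_).trans_lt
      (isCompact_closedBall (0 : EuclideanSpace ℝ (Fin (d - 1)) × ℝ) 1).measure_lt_top).ne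
    intro z hz
    simpa using (norm_le_enorm' z).trans hz.2
  · exact (((hu.comp (measurable_const_add x)).sub_const _).div
      (measurable_enorm'.pow_const _)).aestronglyMeasurable
  · refine (ae_restrict_iff' (measurableSet_enorm'_Ioc ε 1)).2 (ae_of_all _ fun z hz => ?_)
    have h1 : ε ^ ((d : ℝ) + α) ≤ enorm' z ^ ((d : ℝ) + α) :=
      Real.rpow_le_rpow hε.le hz.1.le hN
    have h2 : 0 < ε ^ ((d : ℝ) + α) := Real.rpow_pos_of_pos hε _
    rw [Real.norm_eq_abs, abs_div, abs_of_pos (h2.trans_le h1)]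
    have h3 : |u (x + z) - u x| ≤ 2 * M := by
      have := abs_sub (u (x + z)) (u x)
      linarith [hM (x + z), hM x]
    exact div_le_div₀ ((abs_nonneg _).trans h3) h3 h2 h1

lemma pvInt2Tr_eq_integral_secondDiff (hα : 0 < α) (hu : Measurable u) (hM : ∀ z, |u z| ≤ M)
    (x : EuclideanSpace ℝ (Fin (d - 1)) × ℝ) {ε : ℝ} (hε : 0 < ε) :
    pvInt2Tr d α u x ε = 1 / 2 * ∫ z,
      {z : EuclideanSpace ℝ (Fin (d - 1)) × ℝ | ε < enorm' z ∧ enorm' z ≤ 1}.indicator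
        (fun z => (u (x + z) + u (x - z) - 2 * u x) / enorm' z ^ ((d : ℝ) + α)) z := by
  have hF := integrable_indicator_sub_div hα hu hM x hε
  set F := {z : EuclideanSpace ℝ (Fin (d - 1)) × ℝ | ε < enorm' z ∧ enorm' z ≤ 1}.indicator
      fun z => (u (x + z) - u x) / enorm' z ^ ((d : ℝ) + α) with hFdef
  have h1 : pvInt2Tr d α u x ε = ∫ z, F z := by
    have hS : MeasurableSet {y : EuclideanSpace ℝ (Fin (d - 1)) × ℝ |
        ε < enorm' (y - x) ∧ enorm' (y - x) ≤ 1} :=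
      (measurable_sub_const x) (measurableSet_enorm'_Ioc ε 1)
    rw [pvInt2Tr, ← integral_indicator hS, ← integral_add_left_eq_self _ x]
    refine integral_congr_ae (ae_of_all _ fun z => ?_)
    simp only [hFdef, indicator_apply, mem_ofPred_eq, add_sub_cancel_left]
    rw [show x - (x + z) = -z by abel, enorm'_neg]
  have h2 : ∫ z, F (-z) = ∫ z, F z := integral_neg_eq_self F volume
  have h3 : ∫ z, (F z + F (-z)) = 2 * ∫ z, F z := by
    rw [integral_add hF hF.comp_neg, h2]; ring
  rw [h1, show ∫ z, F z = 1 / 2 * (2 * ∫ z, F z) by ring, ← h3]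
  congr 1
  refine integral_congr_ae (ae_of_all _ fun z => ?_)
  simp only [hFdef, indicator_apply, mem_ofPred_eq, enorm'_neg]
  split_ifs
  · rw [← add_div, ← sub_eq_add_neg]; ring
  · simp

lemma tendsto_pvInt2Tr (hα : 0 < α) (hu : Measurable u) (hM : ∀ z, |u z| ≤ M)
    (x : EuclideanSpace ℝ (Fin (d - 1)) × ℝ)
    (hD : Integrable fun z => {z : EuclideanSpace ℝ (Fin (d - 1)) × ℝ | enorm' z ≤ 1}.indicator
      (fun z => u (x + z) + u (x - z) - 2 * u x) z / enorm' z ^ ((d : ℝ) + α)) :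
    Tendsto (pvInt2Tr d α u x) (nhdsWithin 0 (Ioi 0)) (nhds (1 / 2 * ∫ z,
      {z : EuclideanSpace ℝ (Fin (d - 1)) × ℝ | enorm' z ≤ 1}.indicator
      (fun z => u (x + z) + u (x - z) - 2 * u x) z / enorm' z ^ ((d : ℝ) + α))) := by
  have hev : ∀ᶠ ε in nhdsWithin (0 : ℝ) (Ioi 0), 1 / 2 * (∫ z,
      {z : EuclideanSpace ℝ (Fin (d - 1)) × ℝ | ε < enorm' z ∧ enorm' z ≤ 1}.indicator
        (fun z => (u (x + z) + u (x - z) - 2 * u x) / enorm' z ^ ((d : ℝ) + α)) z) =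
      pvInt2Tr d α u x ε := by
    filter_upwards [self_mem_nhdsWithin] with ε hε
    exact (pvInt2Tr_eq_integral_secondDiff hα hu hM x hε).symm
  refine Tendsto.congr' hev (Tendsto.const_mul _ ?_)
  refine tendsto_integral_filter_of_dominated_convergence _ ?_ ?_ hD.norm ?_
  · refine Eventually.of_forall fun ε => Measurable.aestronglyMeasurable ?_
    exact ((((hu.comp (measurable_const_add x)).add (hu.comp (measurable_const_sub x))).sub_const
      _).div (measurable_enorm'.pow_const _)).indicator (measurableSet_enorm'_Ioc ε 1)
  · refine Eventually.of_forall fun ε => ae_of_all _ fun z => ?_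
    simp only [indicator_apply, mem_ofPred_eq]
    by_cases h1 : enorm' z ≤ 1
    · by_cases h2 : ε < enorm' z
      · simp [h1, h2]
      · rw [if_neg (fun h => h2 h.1), norm_zero]; exact norm_nonneg _
    · simp [h1]
  · refine ae_of_all _ fun z => ?_
    rcases (enorm'_nonneg z).eq_or_lt with h0 | h0
    · have hz : z = 0 := norm_le_zero_iff.1 ((norm_le_enorm' z).trans h0.symm.le)
      refine tendsto_const_nhds.congr fun ε => ?_
      simp [indicator_apply, hz, two_mul]
    · refine tendsto_const_nhds.congr' ?_
      filter_upwards [nhdsWithin_le_nhds (Iio_mem_nhds h0)] with ε hε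
      have hε' : ε < enorm' z := hε
      by_cases h1 : enorm' z ≤ 1 <;> simp [h1, hε']

end PrincipalValue

lemma fracConst_pos (d : ℕ) {α : ℝ} (hα0 : 0 < α) (hα2 : α < 2) : 0 < fracConst d α := by
  have h1 : 0 < Real.Gamma (((d : ℝ) + α) / 2) := Real.Gamma_pos_of_pos (by positivity)
  have h2 : 0 < Real.Gamma (1 - α / 2) := Real.Gamma_pos_of_pos (by linarith)
  have h3 := Real.pi_pos
  unfold fracConst
  positivity

section Bounds

variable {d : ℕ} {α r p N c R : ℝ} {y : EuclideanSpace ℝ (Fin (d - 1)) × ℝ} {ρ : ℝ}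

lemma integral_secondDiff_hfun_bounds (hN : N = ((d - 1 : ℕ) : ℝ) + 1 + α) (hα0 : 0 < α)
    (hα2 : α < 2) (hr : 0 < r) (hr2 : r ≤ 1 / 2) (hp : 0 < p) (hp2 : p < 2) (hpα : p < α)
    (hy : ‖y.1‖ < r / 4) (hy' : enorm' y < 5 * r / 4)
    (hρ : ρ = y.2 - √(r ^ 2 - ‖y.1‖ ^ 2)) (hρ0 : 0 < ρ) (hρr : ρ ≤ r / 2)
    (hc : ∀ n : EuclideanSpace ℝ (Fin (d - 1)), ‖n‖ ≤ 1 →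
      c ≤ ∫ w, posPowDiff p (inner ℝ n w.1 + w.2) / enorm' w ^ N)
    (hR : ∫ z, {w : EuclideanSpace ℝ (Fin (d - 1)) × ℝ | r / (8 * ρ) < ‖w‖}.indicator
      (fun w => minPow p ‖w‖) z / enorm' z ^ N ≤ c / 8192) :
    Integrable (fun z => {z : EuclideanSpace ℝ (Fin (d - 1)) × ℝ | enorm' z ≤ 1}.indicator
      (fun z => hfun d r p (y + z) + hfun d r p (y - z) - 2 * hfun d r p y) z / enorm' z ^ N) ∧
    c / 2 * ρ ^ (p - α) ≤ ∫ z, {z : EuclideanSpace ℝ (Fin (d - 1)) × ℝ | enorm' z ≤ 1}.indicator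
      (fun z => hfun d r p (y + z) + hfun d r p (y - z) - 2 * hfun d r p y) z / enorm' z ^ N ∧
    ∫ z, {z : EuclideanSpace ℝ (Fin (d - 1)) × ℝ | enorm' z ≤ 1}.indicator
      (fun z => hfun d r p (y + z) + hfun d r p (y - z) - 2 * hfun d r p y) z / enorm' z ^ N ≤
    2048 * (∫ w : EuclideanSpace ℝ (Fin (d - 1)) × ℝ, minPow p ‖w‖ / enorm' w ^ N) *
      ρ ^ (p - α) := by
  set D : EuclideanSpace ℝ (Fin (d - 1)) × ℝ → ℝ :=
    {z : EuclideanSpace ℝ (Fin (d - 1)) × ℝ | enorm' z ≤ 1}.indicator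
      fun z => hfun d r p (y + z) + hfun d r p (y - z) - 2 * hfun d r p y with hDdef
  set f : EuclideanSpace ℝ (Fin (d - 1)) × ℝ → ℝ := fun w => D (ρ • w) with hfdef
  have hDf : D = fun z => f (ρ⁻¹ • z) := by
    funext z
    simp only [hfdef, smul_smul, mul_inv_cancel₀ hρ0.ne', one_smul]
  have hDmeas : Measurable D := by
    have hh := measurable_hfun d r p
    exact (((hh.comp (measurable_const_add y)).add (hh.comp (measurable_const_sub y))).sub_const
      _).indicator (measurableSet_le measurable_enorm' measurable_const)
  have hNpos : ∀ w : EuclideanSpace ℝ (Fin (d - 1)) × ℝ, 0 ≤ enorm' w ^ N :=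
    fun w => Real.rpow_nonneg (enorm'_nonneg w) _
  have hρp : 0 < ρ ^ p := Real.rpow_pos_of_pos hρ0 p
  have hmin := integrable_minPow_div (m := d - 1) hα0 hα2 hp2.le hpα hN
  set n : EuclideanSpace ℝ (Fin (d - 1)) := (√(r ^ 2 - ‖y.1‖ ^ 2))⁻¹ • y.1 with hn
  have hn1 : ‖n‖ ≤ 1 := norm_inv_sqrt_smul_le hr hy
  have hpos := integrable_posPowDiff_inner_div hα0 hα2 hp.le hp2.le hpα hN hn1
  have hfabs : ∀ w, |f w| ≤ 2048 * ρ ^ p * minPow p ‖w‖ := by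
    intro w
    simp only [hfdef, hDdef, indicator_apply]
    split_ifs
    · exact abs_hfun_secondDiff_le hr hp hp2.le hy hy' hρ hρ0 hρr w
    · rw [abs_zero]
      exact mul_nonneg (by positivity) (minPow_nonneg p (norm_nonneg w))
  have hflow : ∀ w, ρ ^ p * (posPowDiff p (inner ℝ n w.1 + w.2) -
      4096 * {w : EuclideanSpace ℝ (Fin (d - 1)) × ℝ | r / (8 * ρ) < ‖w‖}.indicator
        (fun w => minPow p ‖w‖) w) ≤ f w := by
    intro w
    by_cases hw : r / (8 * ρ) < ‖w‖
    · rw [indicator_of_mem (by exact hw)]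
      have h1 := abs_le.1 (hfabs w)
      have h2 := (abs_le.1 (abs_posPowDiff_le hp.le hp2.le (abs_inner_add_le hn1 w))).2
      nlinarith [mul_le_mul_of_nonneg_left h2 hρp.le]
    · rw [indicator_of_notMem (by exact hw), mul_zero, sub_zero]
      rw [not_lt, le_div_iff₀ (by positivity)] at hw
      have hw' : ρ * ‖w‖ ≤ r / 8 := by linarith
      have h1 : enorm' (ρ • w) ≤ 1 := by
        rw [enorm'_smul, abs_of_pos hρ0]
        nlinarith [mul_le_mul_of_nonneg_left (enorm'_le_two_mul_norm w) hρ0.le]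
      simp only [hfdef, hDdef]
      rw [indicator_of_mem (by exact h1)]
      exact posPowDiff_le_hfun_secondDiff hr hp hy hy' hρ hρ0 hρr hw'
  have hfint : Integrable fun w => f w / enorm' w ^ N := by
    refine (hmin.const_mul (2048 * ρ ^ p)).mono'
      ((hDmeas.comp (measurable_const_smul ρ)).div
        (measurable_enorm'.pow_const _)).aestronglyMeasurable (ae_of_all _ fun w => ?_)
    rw [Real.norm_eq_abs, abs_div, abs_of_nonneg (hNpos w), ← mul_div_assoc]
    exact div_le_div_of_nonneg_right (hfabs w) (hNpos w)
  have htail : Integrable fun w : EuclideanSpace ℝ (Fin (d - 1)) × ℝ =>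
      {w : EuclideanSpace ℝ (Fin (d - 1)) × ℝ | r / (8 * ρ) < ‖w‖}.indicator
        (fun w => minPow p ‖w‖) w / enorm' w ^ N := by
    have := hmin.indicator (s := {w | r / (8 * ρ) < ‖w‖})
      (measurableSet_lt measurable_const measurable_norm)
    refine this.congr (ae_of_all _ fun w => ?_)
    simp only [indicator_apply]
    split_ifs <;> simp
  have hup : ∫ w, f w / enorm' w ^ N ≤ 2048 * ρ ^ p *
      ∫ w : EuclideanSpace ℝ (Fin (d - 1)) × ℝ, minPow p ‖w‖ / enorm' w ^ N := by
    rw [← integral_const_mul]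
    refine integral_mono hfint (hmin.const_mul _) fun w => ?_
    simp only [← mul_div_assoc]
    exact div_le_div_of_nonneg_right ((le_abs_self _).trans (hfabs w)) (hNpos w)
  have hlow : ρ ^ p * (c / 2) ≤ ∫ w, f w / enorm' w ^ N := by
    have h1 : ρ ^ p * ((∫ w : EuclideanSpace ℝ (Fin (d - 1)) × ℝ,
        posPowDiff p (inner ℝ n w.1 + w.2) / enorm' w ^ N) -
        4096 * ∫ z, {w : EuclideanSpace ℝ (Fin (d - 1)) × ℝ | r / (8 * ρ) < ‖w‖}.indicator
          (fun w => minPow p ‖w‖) z / enorm' z ^ N) ≤ ∫ w, f w / enorm' w ^ N := by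
      rw [← integral_const_mul, ← integral_sub hpos (htail.const_mul _), ← integral_const_mul]
      refine integral_mono ((hpos.sub (htail.const_mul _)).const_mul _) hfint fun w => ?_
      have := div_le_div_of_nonneg_right (hflow w) (hNpos w)
      refine le_trans (le_of_eq ?_) this
      simp only []
      ring
    refine le_trans (mul_le_mul_of_nonneg_left ?_ hρp.le) h1
    linarith [hc n hn1]
  have hscale : ∫ z, D z / enorm' z ^ N = ρ ^ (-α) * ∫ w, f w / enorm' w ^ N := by
    rw [hDf]; exact integral_comp_inv_smul_div hN f hρ0
  have hρα : 0 < ρ ^ (-α) := Real.rpow_pos_of_pos hρ0 _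
  have hexp : ρ ^ (p - α) = ρ ^ (-α) * ρ ^ p := by
    rw [← Real.rpow_add hρ0]; congr 1; ring
  refine ⟨?_, ?_, ?_⟩
  · rw [hDf]; exact integrable_comp_inv_smul_div hρ0 hfint
  · rw [hscale, hexp]
    calc _ = ρ ^ (-α) * (ρ ^ p * (c / 2)) := by ring
      _ ≤ _ := mul_le_mul_of_nonneg_left hlow hρα.le
  · rw [hscale, hexp]
    refine (mul_le_mul_of_nonneg_left hup hρα.le).trans (le_of_eq (by ring))

/-- Just outside the sphere, the vertical height above it is comparable to the distance. -/
lemma vertical_height_bounds {δ : ℝ} (hr : 0 < r) (hy2 : 0 < y.2) (hry : r < enorm' y)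
    (hyδ : enorm' y < r + δ) (hδ : δ ≤ r) (hy : ‖y.1‖ < r / 4) :
    0 < y.2 - √(r ^ 2 - ‖y.1‖ ^ 2) ∧ y.2 - √(r ^ 2 - ‖y.1‖ ^ 2) ≤ 2 * δ := by
  have hv0 := norm_nonneg y.1
  have h0 := Real.sq_sqrt (by positivity : 0 ≤ ‖y.1‖ ^ 2 + y.2 ^ 2)
  change enorm' y ^ 2 = _ at h0
  have hA2 : 0 ≤ r ^ 2 - ‖y.1‖ ^ 2 := by nlinarith
  have hA : 9 / 10 * r ≤ √(r ^ 2 - ‖y.1‖ ^ 2) := Real.le_sqrt_of_sq_le (by nlinarith)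
  have eA := Real.sq_sqrt hA2
  set A := √(r ^ 2 - ‖y.1‖ ^ 2)
  have h1 : (y.2 - A) * (y.2 + A) = (enorm' y - r) * (enorm' y + r) := by
    linear_combination -eA - h0
  have h2 : 0 < y.2 - A := by
    refine pos_of_mul_pos_left (b := y.2 + A) ?_ (by linarith)
    rw [h1]; exact mul_pos (by linarith) (by linarith)
  refine ⟨h2, ?_⟩
  have h3 : (enorm' y - r) * (enorm' y + r) ≤ δ * (3 * r) :=
    mul_le_mul (by linarith) (by linarith) (by linarith) (by linarith)
  by_contra! h4
  have h5 : 2 * δ * (9 / 5 * r) ≤ (y.2 - A) * (y.2 + A) :=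
    mul_le_mul h4.le (by linarith) (by positivity) h2.le
  nlinarith [mul_pos (show 0 < δ by linarith) hr]

end Bounds

/-- For `p ∈ (α/2, α)` there exist `δ ∈ (0, r₁/4]` and constants `C ≥ c > 0` such that
for every `y` with `y_d > 0`, `r₁ < |y| < r₁ + δ`, `|ỹ| < r₁/4`, the limit defining the
truncated fractional Laplacian `Δ̂^{α/2} h_p(y)` exists and
`c (y_d - √(r₁²-|ỹ|²))^{p-α} ≤ Δ̂^{α/2} h_p(y) ≤ C (y_d - √(r₁²-|ỹ|²))^{p-α}`. -/
theorem statement6 (d : ℕ) (hd : 1 ≤ d) (α : ℝ) (hα : α ∈ Set.Ioo (0 : ℝ) 2)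
    (r1 : ℝ) (hr1 : r1 ∈ Set.Ioc (0 : ℝ) (1 / 2)) (p : ℝ) (hp : p ∈ Set.Ioo (α / 2) α) :
    ∃ δ ∈ Set.Ioc (0 : ℝ) (r1 / 4), ∃ c C : ℝ, 0 < c ∧ c ≤ C ∧
      ∀ y : EuclideanSpace ℝ (Fin (d - 1)) × ℝ,
        0 < y.2 → r1 < enorm' y → enorm' y < r1 + δ → ‖y.1‖ < r1 / 4 →
        ∃ L : ℝ,
          Filter.Tendsto (pvInt2Tr d α (hfun d r1 p) y)
            (nhdsWithin 0 (Set.Ioi 0)) (nhds L) ∧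
          c * (y.2 - Real.sqrt (r1 ^ 2 - ‖y.1‖ ^ 2)) ^ (p - α) ≤ fracConst d α * L ∧
          fracConst d α * L ≤ C * (y.2 - Real.sqrt (r1 ^ 2 - ‖y.1‖ ^ 2)) ^ (p - α) := by
  obtain ⟨hα0, hα2⟩ := hα
  obtain ⟨hr0, hr2⟩ := hr1
  obtain ⟨hp1, hpα⟩ := hp
  have hp0 : 0 < p := by linarith
  have hp2 : p < 2 := by linarith
  have hN : (d : ℝ) + α = ((d - 1 : ℕ) : ℝ) + 1 + α := by
    rw [Nat.cast_sub hd]; push_cast; ring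
  obtain ⟨c, hc0, hc⟩ := exists_pos_le_integral_posPowDiff_inner_div hα0 hα2 hp1 hpα hN
  obtain ⟨R, hR0, hR⟩ := exists_forall_integral_indicator_minPow_le hα0 hα2 hp2.le hpα hN
    (by positivity : 0 < c / 8192)
  have hA := fracConst_pos d hα0 hα2
  set K := ∫ w : EuclideanSpace ℝ (Fin (d - 1)) × ℝ, minPow p ‖w‖ / enorm' w ^ ((d : ℝ) + α)
  refine ⟨min (r1 / 16) (r1 / (16 * R)), ⟨by positivity, (min_le_left _ _).trans (by linarith)⟩,
    fracConst d α * (c / 4), max (fracConst d α * (c / 4)) (fracConst d α * (1024 * K)),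
    by positivity, le_max_left _ _, fun y hy2 hry hyδ hy => ?_⟩
  set δ := min (r1 / 16) (r1 / (16 * R))
  have hδ1 : δ ≤ r1 / 16 := min_le_left _ _
  have hδ2 : δ ≤ r1 / (16 * R) := min_le_right _ _
  obtain ⟨hρ0, hρδ⟩ := vertical_height_bounds hr0 hy2 hry hyδ (by linarith) hy
  set ρ := y.2 - √(r1 ^ 2 - ‖y.1‖ ^ 2) with hρ
  have hRρ : R ≤ r1 / (8 * ρ) := by
    rw [le_div_iff₀ (by positivity)] at hδ2 ⊢
    nlinarith [mul_le_mul_of_nonneg_right hρδ hR0.le]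
  obtain ⟨hint, hlow, hup⟩ := integral_secondDiff_hfun_bounds hN hα0 hα2 hr0 hr2 hp0 hp2 hpα hy
    (by linarith) hρ hρ0 (by linarith) hc (hR _ hRρ)
  have hbdd : ∀ z, |hfun d r1 p z| ≤ (3 * r1 / 2) ^ p := fun z => by
    rw [abs_of_nonneg (hfun_nonneg hr0 hp0 z)]
    exact hfun_le_const hr0 hp0 z
  refine ⟨_, tendsto_pvInt2Tr hα0 (measurable_hfun d r1 p) hbdd y hint, ?_, ?_⟩
  · calc _ = fracConst d α * (1 / 2 * (c / 2 * ρ ^ (p - α))) := by ring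
      _ ≤ _ := by gcongr
  · calc _ ≤ fracConst d α * (1 / 2 * (2048 * K * ρ ^ (p - α))) := by gcongr
      _ = fracConst d α * (1024 * K) * ρ ^ (p - α) := by ring
      _ ≤ _ := mul_le_mul_of_nonneg_right (le_max_right _ _) (Real.rpow_nonneg hρ0.le _)
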